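/- arXiv:2004.13814 — 6 statements merged into one kernel-verified Lean document; each statement's English description precedes it below -/
import Mathlib

section
/- Let n ≥ 3 and let e be an edge of the complete graph K_{n+1} on {0,1,…,n} joining two distinct vertices i, j ∈ [n] (i.e., an edge not through the root 0). Then the number of spherical parking functions of K_{n+1} − {e} is |sPF(K_{n+1} − {e})| = (n−1)^{n−3}(n−2)^2. -/
/-- `dA a A i` is the number of edges from the non-root vertex `i+1` to vertices outside
`A` in the multigraph on `{0,1,…,n}` with adjacency matrix `a`. -/
def dA {n : ℕ} (a : Fin (n + 1) → Fin (n + 1) → ℕ) (A : Finset (Fin n)) (i : Fin n) : ℕ :=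
  a i.succ 0 + ∑ j ∈ Aᶜ, a i.succ j.succ

/-- The set of spherical `G`-parking functions of the multigraph on `{0,…,n}` with
adjacency matrix `a`. -/
def sPF {n : ℕ} (a : Fin (n + 1) → Fin (n + 1) → ℕ) : Set (Fin n → ℕ) :=
  {P | (∀ i, dA a Finset.univ i ≤ P i) ∧
    ∀ A : Finset (Fin n), A.Nonempty → A ≠ Finset.univ → ∃ i ∈ A, P i < dA a A i}


open Finset

/-- Sum of the first `t` terms of the periodic sequence `c 0, c 1, …`. -/
def walk {N : ℕ} (c : ZMod N → ℤ) (t : ℕ) : ℤ := ∑ i ∈ range t, c i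

/-- Sum of the `k` consecutive terms of `c` starting at `s`. -/
def arcSum {N : ℕ} (c : ZMod N → ℤ) (s : ZMod N) (k : ℕ) : ℤ := ∑ i ∈ range k, c (s + i)

theorem arcSum_natCast {N : ℕ} (c : ZMod N → ℤ) (t k : ℕ) :
    arcSum c t k = walk c (t + k) - walk c t := by
  simp [arcSum, walk, Finset.sum_range_add]

theorem walk_period {N : ℕ} [NeZero N] (c : ZMod N → ℤ) : walk c N = ∑ z, c z := by
  obtain ⟨m, rfl⟩ := Nat.exists_eq_succ_of_ne_zero (NeZero.ne N)
  unfold walk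
  rw [Finset.sum_range]
  refine Finset.sum_congr rfl fun i _ => ?_
  congr 1
  exact Fin.cast_val_eq_self i

theorem walk_add_period {N : ℕ} [NeZero N] (c : ZMod N → ℤ) (t : ℕ) :
    walk c (t + N) = walk c t + ∑ z, c z := by
  rw [add_comm t N, ← walk_period]
  simp [walk, Finset.sum_range_add, add_comm]

/-- Cycle lemma: a cyclic sequence with sum `1` has exactly one starting point from which all
partial sums are positive. -/
theorem existsUnique_arcSum_pos {N : ℕ} [NeZero N] (c : ZMod N → ℤ) (hc : ∑ z, c z = 1) :
    ∃! s, ∀ k, 1 ≤ k → k ≤ N → 0 < arcSum c s k := by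
  have hN : 0 < N := Nat.pos_of_ne_zero (NeZero.ne N)
  have hper := fun t => hc ▸ walk_add_period c t
  refine existsUnique_of_exists_of_unique ?_ ?_
  · obtain ⟨t, ht, hmin⟩ := exists_min_image (range N)
      (fun t => toLex (walk c t, -(t : ℤ))) ⟨0, by simpa using hN⟩
    rw [mem_range] at ht
    refine ⟨t, fun k hk hkN => ?_⟩
    rw [arcSum_natCast]
    rcases lt_or_ge (t + k) N with h | h
    · have := hmin (t + k) (by simpa using h)
      rw [Prod.Lex.toLex_le_toLex] at this
      push_cast at this
      omega
    · obtain ⟨u, hu⟩ := Nat.exists_eq_add_of_le' h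
      have := hmin u (by simp; omega)
      rw [Prod.Lex.toLex_le_toLex] at this
      rw [hu, hper]
      omega
  · have key : ∀ s s' : ZMod N, (∀ k, 1 ≤ k → k ≤ N → 0 < arcSum c s k) →
        (∀ k, 1 ≤ k → k ≤ N → 0 < arcSum c s' k) → ¬ s.val < s'.val := by
      intro s s' hs hs' hlt
      have hb := s'.val_lt
      have h1 := hs (s'.val - s.val) (by omega) (by omega)
      have h2 := hs' (s.val + N - s'.val) (by omega) (by omega)
      rw [← ZMod.natCast_zmod_val s, arcSum_natCast, ZMod.natCast_zmod_val,
        Nat.add_sub_cancel' hlt.le] at h1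
      rw [← ZMod.natCast_zmod_val s', arcSum_natCast, ZMod.natCast_zmod_val,
        Nat.add_sub_cancel' (by omega), hper] at h2
      omega
    intro s s' hs hs'
    exact ZMod.val_injective N (le_antisymm (not_lt.1 (key _ _ hs' hs)) (not_lt.1 (key _ _ hs hs')))

/-- Cycle lemma: a cyclic sequence with sum `-1` has exactly one starting point from which all
proper partial sums are nonnegative. -/
theorem existsUnique_arcSum_nonneg {N : ℕ} [NeZero N] (c : ZMod N → ℤ) (hc : ∑ z, c z = -1) :
    ∃! s, ∀ k < N, 0 ≤ arcSum c s k := by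
  have hN : 0 < N := Nat.pos_of_ne_zero (NeZero.ne N)
  have hper := fun t => hc ▸ walk_add_period c t
  refine existsUnique_of_exists_of_unique ?_ ?_
  · obtain ⟨t, ht, hmin⟩ := exists_min_image (range N)
      (fun t => toLex (walk c t, (t : ℤ))) ⟨0, by simpa using hN⟩
    rw [mem_range] at ht
    refine ⟨t, fun k hkN => ?_⟩
    rw [arcSum_natCast]
    rcases lt_or_ge (t + k) N with h | h
    · have := hmin (t + k) (by simpa using h)
      rw [Prod.Lex.toLex_le_toLex] at this
      omega
    · obtain ⟨u, hu⟩ := Nat.exists_eq_add_of_le' h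
      have := hmin u (by simp; omega)
      rw [Prod.Lex.toLex_le_toLex] at this
      rw [hu, hper]
      omega
  · have key : ∀ s s' : ZMod N, (∀ k < N, 0 ≤ arcSum c s k) →
        (∀ k < N, 0 ≤ arcSum c s' k) → ¬ s.val < s'.val := by
      intro s s' hs hs' hlt
      have hb := s'.val_lt
      have h1 := hs (s'.val - s.val) (by omega)
      have h2 := hs' (s.val + N - s'.val) (by omega)
      rw [← ZMod.natCast_zmod_val s, arcSum_natCast, ZMod.natCast_zmod_val,
        Nat.add_sub_cancel' hlt.le] at h1
      rw [← ZMod.natCast_zmod_val s', arcSum_natCast, ZMod.natCast_zmod_val,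
        Nat.add_sub_cancel' (by omega), hper] at h2
      omega
    intro s s' hs hs'
    exact ZMod.val_injective N (le_antisymm (not_lt.1 (key _ _ hs' hs)) (not_lt.1 (key _ _ hs hs')))

section Excess

variable {V : Type*} {N : ℕ}

/-- The number of `v ∈ S` with `f v = z`, minus one. -/
def excess (S : Finset V) (f : V → ZMod N) (z : ZMod N) : ℤ := #{v ∈ S | f v = z} - 1

theorem sum_excess [NeZero N] (S : Finset V) (f : V → ZMod N) :
    ∑ z, excess S f z = #S - N := by
  have h := card_eq_sum_card_fiberwise (f := f) (s := S) (t := univ) (fun _ _ => by simp)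
  simp [excess, h, ZMod.card]

theorem arcSum_excess_add (S : Finset V) (f : V → ZMod N) (s t : ZMod N) (k : ℕ) :
    arcSum (excess S fun v => f v + t) (s + t) k = arcSum (excess S f) s k := by
  simp only [arcSum, excess]
  refine sum_congr rfl fun i _ => ?_
  simp only [add_right_comm s t, add_left_inj]

theorem arcSum_zero (c : ZMod N → ℤ) (k : ℕ) : arcSum c 0 k = walk c k := by
  simp [arcSum, walk]

theorem walk_excess [NeZero N] (S : Finset V) (f : V → ZMod N) {k : ℕ} (hk : k ≤ N) :
    walk (excess S f) k = #{v ∈ S | (f v).val < k} - k := by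
  have h := card_eq_sum_card_fiberwise (f := fun v => (f v).val)
    (s := {v ∈ S | (f v).val < k}) (t := range k) (fun v hv => by simpa using (mem_filter.1 hv).2)
  simp only [walk, excess, h, sum_sub_distrib, sum_const, card_range, Nat.cast_sum, nsmul_eq_mul,
    mul_one, filter_filter]
  congr 1
  refine sum_congr rfl fun i hi => ?_
  rw [mem_range] at hi
  congr 2
  ext v
  simp only [mem_filter]
  refine and_congr_right fun _ => ⟨?_, ?_⟩
  · intro h
    have : (f v).val = i := by rw [h, ZMod.val_natCast_of_lt (hi.trans_le hk)]
    omega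
  · rintro ⟨-, h⟩
    rw [← h, ZMod.natCast_zmod_val]

end Excess

section Counting

variable {V : Type*} [Fintype V] {N : ℕ}

theorem existsUnique_prime_start [NeZero N] (hV : Fintype.card V = N + 1) (f : V → ZMod N) :
    ∃! s, ∀ k, 1 ≤ k → k ≤ N → 0 < arcSum (excess univ f) s k := by
  refine existsUnique_arcSum_pos _ ?_
  rw [sum_excess, card_univ, hV]
  push_cast
  ring

variable [DecidableEq V]

theorem existsUnique_rest_start [NeZero N] (hV : Fintype.card V = N + 1) {x y : V} (hxy : x ≠ y)
    (f : V → ZMod N) : ∃! t, ∀ k < N, 0 ≤ arcSum (excess ({x, y} : Finset V)ᶜ f) t k := by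
  refine existsUnique_arcSum_nonneg _ ?_
  have h := card_add_card_compl ({x, y} : Finset V)
  rw [card_pair hxy, hV] at h
  rw [sum_excess]
  omega

/-- `f` parks neither `x` nor `y` at the spot left empty by the other cars on a circle of `N`
spots; that spot precedes the start `t` of the cycle lemma. -/
def AvoidsEmptySpot (x y : V) (f : V → ZMod N) : Prop :=
  ∀ t, (∀ k < N, 0 ≤ arcSum (excess ({x, y} : Finset V)ᶜ f) t k) → f x + 1 ≠ t ∧ f y + 1 ≠ t

theorem avoidsEmptySpot_add (x y : V) (f : V → ZMod N) (s : ZMod N) :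
    AvoidsEmptySpot x y (fun v => f v + s) ↔ AvoidsEmptySpot x y f := by
  unfold AvoidsEmptySpot
  rw [← (Equiv.addRight s).forall_congr_right]
  simp only [Equiv.coe_addRight, arcSum_excess_add, add_right_comm _ s, ne_eq, add_left_inj]

variable [NeZero N]

open Classical in
theorem card_avoidsEmptySpot (hV : Fintype.card V = N + 1) {x y : V} (hxy : x ≠ y) :
    #{f : V → ZMod N | AvoidsEmptySpot x y f} = (N - 1) ^ 2 * N ^ (N - 1) := by
  choose T hT hTuniq using fun f => existsUnique_rest_start (N := N) hV hxy f
  have hTcongr : ∀ f g : V → ZMod N, (∀ v, v ≠ x → v ≠ y → f v = g v) → T f = T g := by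
    intro f g hfg
    apply hTuniq
    have : excess ({x, y} : Finset V)ᶜ f = excess ({x, y} : Finset V)ᶜ g := by
      funext z
      unfold excess
      congr 3
      refine filter_congr fun v hv => ?_
      simp only [mem_compl, mem_insert, mem_singleton, not_or] at hv
      rw [hfg v hv.1 hv.2]
    simpa only [← this] using hT f
  let Φ : (V → ZMod N) → (V → ZMod N) := fun f v =>
    if v = x ∨ v = y then f v + 1 - T f else f v
  have hΦ : Function.Injective Φ := by
    intro f g hfg
    have hpt := congrFun hfg
    have hTT : T f = T g := hTcongr f g fun v hx hy => by simpa [Φ, hx, hy] using hpt v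
    funext v
    have := hpt v
    by_cases h : v = x ∨ v = y
    · simpa [Φ, h, hTT] using this
    · simpa [Φ, h] using this
  have hcard : #{f : V → ZMod N | AvoidsEmptySpot x y f} =
      #{g : V → ZMod N | g x ≠ 0 ∧ g y ≠ 0} := by
    refine card_equiv (Equiv.ofBijective Φ (Finite.injective_iff_bijective.1 hΦ)) fun f => ?_
    have : AvoidsEmptySpot x y f ↔ f x + 1 ≠ T f ∧ f y + 1 ≠ T f :=
      ⟨fun h => h _ (hT f), fun h t ht => (hTuniq f t ht) ▸ h⟩
    simp [this, Φ, sub_eq_zero]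
  have hpi : ({g : V → ZMod N | g x ≠ 0 ∧ g y ≠ 0} : Finset _) =
      Fintype.piFinset fun v => if v ∈ ({x, y} : Finset V) then univ.erase 0 else univ := by
    ext g
    simp only [mem_filter, mem_univ, true_and, Fintype.mem_piFinset]
    constructor
    · intro h v
      split_ifs with hv
      · rcases mem_insert.1 hv with rfl | hv
        · simpa using h.1
        · rw [mem_singleton.1 hv]
          simpa using h.2
      · simp
    · intro h
      exact ⟨by simpa using h x, by simpa using h y⟩
  rw [hcard, hpi, Fintype.card_piFinset]
  have hc := card_add_card_compl ({x, y} : Finset V)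
  rw [card_pair hxy, hV] at hc
  simp only [apply_ite card, card_univ, ZMod.card, card_erase_of_mem (mem_univ (0 : ZMod N))]
  rw [prod_ite, prod_const, prod_const, filter_mem_eq_inter, univ_inter, card_pair hxy,
    filter_notMem_eq_sdiff, ← compl_eq_univ_sdiff]
  congr 2
  omega

open Classical in
theorem card_prime_avoidsEmptySpot (hV : Fintype.card V = N + 1) {x y : V} (hxy : x ≠ y) :
    N * #{f : V → ZMod N | (∀ k, 1 ≤ k → k ≤ N → 0 < walk (excess univ f) k) ∧
      AvoidsEmptySpot x y f} = (N - 1) ^ 2 * N ^ (N - 1) := by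
  choose s hs hsuniq using fun f => existsUnique_prime_start (V := V) (N := N) hV f
  rw [← card_avoidsEmptySpot hV hxy, card_eq_sum_card_fiberwise (f := s) (t := univ)
      (s := {f : V → ZMod N | AvoidsEmptySpot x y f}) (fun _ _ => by simp)]
  nth_rw 1 [← ZMod.card N]
  refine (sum_const_nat fun t _ => ?_).symm
  symm
  refine card_equiv (Equiv.addRight fun _ => t) fun f => ?_
  have hst : s (fun v => f v + t) = t ↔ ∀ k, 1 ≤ k → k ≤ N → 0 < walk (excess univ f) k := by
    simp only [← arcSum_zero, ← arcSum_excess_add univ f 0 t, zero_add]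
    refine ⟨fun h => ?_, fun h => (hsuniq _ _ h).symm⟩
    have := hs (fun v => f v + t)
    rwa [h] at this
  have ha := avoidsEmptySpot_add x y f t
  simp only [mem_filter, mem_univ, true_and, Equiv.coe_addRight, Pi.add_def]
  rw [ha, hst, and_comm]

/-- For a prime parking function, the spot of `x` is the one left empty by the cars other than
`x` and `y` iff it is at least the spot of `y` and is filled without slack. -/
theorem rest_start_iff {x y : V} (hV : Fintype.card V = N + 1) (hxy : x ≠ y) {f : V → ZMod N}
    (hf : ∀ k, 1 ≤ k → k ≤ N → 0 < walk (excess univ f) k) :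
    (∀ k < N, 0 ≤ arcSum (excess ({x, y} : Finset V)ᶜ f) (f x + 1) k) ↔
      (f y).val ≤ (f x).val ∧ #{v | (f v).val ≤ (f x).val} = (f x).val + 2 := by
  set e := (f x).val with he
  have heN : e < N := (f x).val_lt
  have hcast : f x + 1 = ((e + 1 : ℕ) : ZMod N) := by simp [he]
  have hrest : ∀ k ≤ N, walk (excess ({x, y} : Finset V)ᶜ f) k = walk (excess univ f) k -
      (if e < k then 1 else 0) - (if (f y).val < k then 1 else 0) := by
    intro k hk
    rw [walk_excess _ _ hk, walk_excess _ _ hk]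
    have h1 := card_filter_add_card_filter_not (s := ({v | (f v).val < k} : Finset V))
      (fun v => v ∈ ({x, y} : Finset V)ᶜ)
    have h2 : filter (fun v => v ∈ ({x, y} : Finset V)ᶜ) ({v | (f v).val < k} : Finset V) =
        filter (fun v => (f v).val < k) ({x, y} : Finset V)ᶜ := by
      ext v; simp [and_comm]
    have h3 : filter (fun v => v ∉ ({x, y} : Finset V)ᶜ) ({v | (f v).val < k} : Finset V) =
        filter (fun v => (f v).val < k) ({x, y} : Finset V) := by
      ext v
      simp only [mem_filter, mem_univ, mem_compl, true_and, not_not, and_comm]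
    have h4 : #(filter (fun v => (f v).val < k) ({x, y} : Finset V)) =
        (if e < k then 1 else 0) + (if (f y).val < k then 1 else 0) := by
      rw [card_filter, sum_pair hxy]
    rw [h2, h3, h4] at h1
    rw [← h1]
    push_cast
    ring
  have hW1 := walk_excess univ f (k := e + 1) heN
  simp only [Nat.lt_succ_iff] at hW1
  have hWN := walk_excess univ f (k := N) le_rfl
  simp only [ZMod.val_lt, filter_true, card_univ, hV] at hWN
  have hyN := (f y).val_lt
  have hpos1 := hf (e + 1) (by omega) heN
  have hr1 := hrest (e + 1) heN
  have hrN := hrest N le_rfl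
  rw [if_pos (by omega)] at hr1
  rw [if_pos heN, if_pos hyN] at hrN
  have hsum : ∑ z, excess ({x, y} : Finset V)ᶜ f z = -1 := by
    rw [← walk_period]
    omega
  rw [hcast]
  simp only [arcSum_natCast]
  constructor
  · intro h
    rcases Nat.lt_or_ge (e + 1) N with hlt | hge
    · have := h (N - (e + 1)) (by omega)
      rw [Nat.add_sub_cancel' heN] at this
      split_ifs at hr1 <;> omega
    · have hNe : N = e + 1 := by omega
      rw [← hNe] at hW1
      omega
  · rintro ⟨hye, hcard⟩ k hk
    rw [if_pos (by omega)] at hr1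
    rcases Nat.lt_or_ge N (e + 1 + k) with hlt | hge
    · obtain ⟨u, hu⟩ : ∃ u, e + 1 + k = u + N := Nat.exists_eq_add_of_le' hlt.le
      rw [hu, walk_add_period, hsum, hrest u (by omega)]
      by_cases hu0 : u = 0
      · have h0 : walk (excess univ f) 0 = 0 := rfl
        simp only [hu0, h0, Nat.not_lt_zero, if_false]
        omega
      · have := hf u (by omega) (by omega)
        rw [if_neg (by omega : ¬ e < u)]
        split_ifs <;> omega
    · have := hf (e + 1 + k) (by omega) hge
      rw [hrest _ hge, if_pos (by omega), if_pos (by omega)]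
      omega

theorem avoidsEmptySpot_iff {x y : V} (hV : Fintype.card V = N + 1) (hxy : x ≠ y) {f : V → ZMod N}
    (hf : ∀ k, 1 ≤ k → k ≤ N → 0 < walk (excess univ f) k) :
    AvoidsEmptySpot x y f ↔
      ¬ ((f y).val ≤ (f x).val ∧ #{v | (f v).val ≤ (f x).val} = (f x).val + 2) ∧
      ¬ ((f x).val ≤ (f y).val ∧ #{v | (f v).val ≤ (f y).val} = (f y).val + 2) := by
  rw [← rest_start_iff hV hxy hf, ← rest_start_iff hV hxy.symm hf, pair_comm y x]
  refine ⟨fun h => ⟨fun h' => (h _ h').1 rfl, fun h' => (h _ h').2 rfl⟩, ?_⟩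
  rintro ⟨h1, h2⟩ t ht
  exact ⟨fun h => h1 (h ▸ ht), fun h => h2 (h ▸ ht)⟩

end Counting

theorem dA_complete_sub_edge {n : ℕ} {x y v : Fin n} {A : Finset (Fin n)} (hxy : x ≠ y)
    (hv : v ∈ A) :
    dA (fun u v : Fin (n + 1) =>
        if u = v then 0
        else if (u = x.succ ∧ v = y.succ) ∨ (u = y.succ ∧ v = x.succ) then 0
        else 1) A v + (if v = x ∧ y ∉ A ∨ v = y ∧ x ∉ A then 1 else 0) + #A = n + 1 := by
  have hA := card_add_card_compl A
  rw [Fintype.card_fin] at hA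
  have key : ∑ j ∈ Aᶜ, (if v.succ = j.succ then 0
        else if (v.succ = x.succ ∧ j.succ = y.succ) ∨ (v.succ = y.succ ∧ j.succ = x.succ) then 0
        else 1) + (if v = x ∧ y ∉ A ∨ v = y ∧ x ∉ A then 1 else 0) = #Aᶜ := by
    have hsplit : (if v = x ∧ y ∉ A ∨ v = y ∧ x ∉ A then 1 else 0) =
        ∑ j ∈ Aᶜ, if (v = x ∧ j = y) ∨ (v = y ∧ j = x) then 1 else 0 := by
      rcases eq_or_ne v x with rfl | hx
      · simp [hxy]
      · rcases eq_or_ne v y with rfl | hy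
        · simp [hx]
        · simp [hx, hy]
    rw [hsplit, ← sum_add_distrib, card_eq_sum_ones]
    refine sum_congr rfl fun j hj => ?_
    have hvj : v ≠ j := by
      rintro rfl
      exact (mem_compl.1 hj) hv
    simp only [Fin.succ_inj, hvj, if_false]
    split_ifs <;> rfl
  unfold dA
  simp only [Fin.succ_ne_zero, (Fin.succ_ne_zero _).symm, and_false, or_self, if_false] at key ⊢
  omega

/-- Spherical parking functions of a complete graph minus an edge, shifted down by one, are the
prime parking functions in which neither end of the edge, being the later one of the two, is
parked without slack. -/
theorem add_one_mem_sPF_iff {N : ℕ} (hN : 2 ≤ N) {x y : Fin (N + 1)} (hxy : x ≠ y)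
    (q : Fin (N + 1) → ℕ) :
    (fun v => q v + 1) ∈ sPF (fun u v : Fin (N + 1 + 1) =>
        if u = v then 0
        else if (u = x.succ ∧ v = y.succ) ∨ (u = y.succ ∧ v = x.succ) then 0
        else 1) ↔
      (∀ k, 1 ≤ k → k ≤ N → k < #{v | q v < k}) ∧
      ¬ (q y ≤ q x ∧ #{v | q v ≤ q x} = q x + 2) ∧
      ¬ (q x ≤ q y ∧ #{v | q v ≤ q y} = q y + 2) := by
  have hd := fun A v hv => dA_complete_sub_edge (n := N + 1) (v := v) (A := A) hxy hv
  set a : Fin (N + 1 + 1) → Fin (N + 1 + 1) → ℕ := fun u v =>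
    if u = v then 0
    else if (u = x.succ ∧ v = y.succ) ∨ (u = y.succ ∧ v = x.succ) then 0
    else 1
  have hcompl : ∀ k, #{v | q v < k} + #{v | k ≤ q v} = N + 1 := by
    intro k
    have := card_filter_add_card_filter_not (s := (univ : Finset (Fin (N + 1)))) (fun v => q v < k)
    simpa using this
  constructor
  · rintro ⟨-, h⟩
    have hne : ∀ A : Finset (Fin (N + 1)), A.Nonempty → A ≠ univ → ∃ v ∈ A,
        q v + (if v = x ∧ y ∉ A ∨ v = y ∧ x ∉ A then 1 else 0) + #A < N + 1 := by
      intro A hA hA'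
      obtain ⟨v, hv, hlt⟩ := h A hA hA'
      have := hd A v hv
      dsimp only at hlt
      exact ⟨v, hv, by omega⟩
    have hbad : ∀ z w : Fin (N + 1), z ≠ w →
        (∀ (A : Finset (Fin (N + 1))) (v : Fin (N + 1)),
          v = z ∧ w ∉ A → v = x ∧ y ∉ A ∨ v = y ∧ x ∉ A) →
        ¬ (q w ≤ q z ∧ #{v | q v ≤ q z} = q z + 2) := by
      rintro z w hzw hcond ⟨hwz, hcard⟩
      have hA := hcompl (q z + 1)
      simp only [Nat.lt_succ_iff] at hA
      have hcA := card_insert_of_notMem (s := ({v | q z + 1 ≤ q v} : Finset (Fin (N + 1)))) (a := z)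
        (by simp)
      have hw : w ∉ insert z ({v | q z + 1 ≤ q v} : Finset (Fin (N + 1))) := by
        simp [hzw.symm]
        omega
      obtain ⟨v, hv, hlt⟩ := hne (insert z ({v | q z + 1 ≤ q v} : Finset (Fin (N + 1))))
        (insert_nonempty _ _) (fun h => hw (by rw [h]; exact mem_univ w))
      rcases mem_insert.1 hv with rfl | hv
      · rw [if_pos (hcond _ _ ⟨rfl, hw⟩)] at hlt
        omega
      · have := (mem_filter.1 hv).2
        omega
    refine ⟨fun k hk hkN => ?_, hbad x y hxy fun _ _ => Or.inl, hbad y x hxy.symm fun _ _ => Or.inr⟩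
    by_contra! hle
    have hc := hcompl k
    rcases Nat.lt_or_ge k N with hlt | hge
    · obtain ⟨A, hAsub, hAcard⟩ := exists_subset_card_eq (s := ({v | k ≤ q v} : Finset _))
        (n := N + 1 - k) (by omega)
      obtain ⟨v, hv, hlt⟩ := hne A (card_pos.1 (by omega)) (by
        rintro rfl
        simp at hAcard
        omega)
      have := (mem_filter.1 (hAsub hv)).2
      omega
    · obtain rfl : k = N := by omega
      obtain ⟨v, hv⟩ := card_pos.1 (by omega : 0 < #{v | k ≤ q v})
      have hv := (mem_filter.1 hv).2
      obtain ⟨w, hw, hlt⟩ := hne {v} (singleton_nonempty v) (by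
        intro h
        have := congrArg card h
        simp at this
        omega)
      rw [mem_singleton] at hw
      subst hw
      simp only [card_singleton] at hlt
      omega
  · rintro ⟨hprime, hx, hy⟩
    refine ⟨fun v => ?_, fun A hA hA' => ?_⟩
    · have := hd univ v (mem_univ v)
      simp only [mem_univ, not_true_eq_false, and_false, or_self, if_false, card_univ,
        Fintype.card_fin] at this
      dsimp only
      omega
    by_contra! hcon
    have hge : ∀ v ∈ A, N + 1 ≤ q v + (if v = x ∧ y ∉ A ∨ v = y ∧ x ∉ A then 1 else 0) + #A := by
      intro v hv
      have := hd A v hv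
      have := hcon v hv
      omega
    have hApos := card_pos.2 hA
    have hAlt : #A < N + 1 := by
      simpa using card_lt_card (ssubset_univ_iff.2 hA')
    obtain ⟨k, hk⟩ := Nat.exists_eq_add_of_lt hAlt
    have hpk := hprime (k + 1) (by omega) (by omega)
    have hck := hcompl (k + 1)
    have hmain : ∀ z w : Fin (N + 1), z ≠ w → z ∈ A → w ∉ A → q z < k + 1 →
        (∀ v, (v = x ∧ y ∉ A ∨ v = y ∧ x ∉ A) → v ∈ A → v = z) →
        q w ≤ q z ∧ #{v | q v ≤ q z} = q z + 2 := by
      intro z w hzw hz hw hqz hcond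
      have hqz' : q z = k := by
        have := hge z hz
        split_ifs at this <;> omega
      have hsub : A.erase z ⊆ ({v | k + 1 ≤ q v} : Finset (Fin (N + 1))) := by
        intro v hv
        obtain ⟨hvz, hvA⟩ := mem_erase.1 hv
        have := hge v hvA
        rw [if_neg fun h => hvz (hcond v h hvA)] at this
        simp only [mem_filter, mem_univ, true_and]
        omega
      have hcA := card_erase_of_mem hz
      have hle := card_le_card hsub
      have heq := eq_of_subset_of_card_le hsub (by omega)
      constructor
      · by_contra! h
        have : w ∈ A.erase z := by
          rw [heq]
          simp
          omega
        exact hw (mem_of_mem_erase this)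
      · simp only [hqz', ← Nat.lt_add_one_iff]
        rw [← heq] at hck
        omega
    have hex : ∃ v ∈ A, q v < k + 1 := by
      by_contra! h
      have := card_le_card (show A ⊆ ({v | k + 1 ≤ q v} : Finset (Fin (N + 1))) from
        fun v hv => by simpa using h v hv)
      omega
    obtain ⟨v, hvA, hv⟩ := hex
    have := hge v hvA
    split_ifs at this with hif
    · rcases hif with ⟨rfl, hyA⟩ | ⟨rfl, hxA⟩
      · refine hx (hmain v y hxy hvA hyA hv ?_)
        rintro u (⟨rfl, -⟩ | ⟨rfl, -⟩) hu
        · rfl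
        · exact absurd hu hyA
      · refine hy (hmain v x hxy.symm hvA hxA hv ?_)
        rintro u (⟨rfl, -⟩ | ⟨rfl, -⟩) hu
        · exact absurd hu hxA
        · rfl
    · omega

/-- For any edge `e` of `K_{n+1}` joining two distinct non-root vertices `i, j ∈ [n]`,
the number of spherical parking functions of `K_{n+1} − {e}` is
`(n−1)^{n−3}(n−2)^2`. -/
theorem stmt14 (n : ℕ) (hn : 3 ≤ n) (i j : Fin (n + 1))
    (hi : i ≠ 0) (hj : j ≠ 0) (hij : i ≠ j) :
    (sPF (n := n) (fun u v =>
        if u = v then 0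
        else if (u = i ∧ v = j) ∨ (u = j ∧ v = i) then 0
        else 1)).ncard = (n - 1) ^ (n - 3) * (n - 2) ^ 2 := by
  classical
  obtain ⟨m, rfl⟩ : ∃ m, n = m + 2 + 1 := ⟨n - 3, by omega⟩
  obtain ⟨x, rfl⟩ := (Fin.exists_succ_eq (n := m + 2 + 1)).2 hi
  obtain ⟨y, rfl⟩ := (Fin.exists_succ_eq (n := m + 2 + 1)).2 hj
  have hxy : x ≠ y := fun h => hij (h ▸ rfl)
  have hV : Fintype.card (Fin (m + 2 + 1)) = (m + 2) + 1 := Fintype.card_fin _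
  have hgood : ∀ f : Fin (m + 2 + 1) → ZMod (m + 2),
      ((∀ k, 1 ≤ k → k ≤ m + 2 → 0 < walk (excess univ f) k) ∧ AvoidsEmptySpot x y f) ↔
      (fun v => (f v).val + 1) ∈ sPF (fun u v : Fin (m + 2 + 1 + 1) =>
        if u = v then 0
        else if (u = x.succ ∧ v = y.succ) ∨ (u = y.succ ∧ v = x.succ) then 0
        else 1) := by
    intro f
    rw [add_one_mem_sPF_iff (by omega) hxy]
    have hiff : (∀ k, 1 ≤ k → k ≤ m + 2 → 0 < walk (excess univ f) k) ↔
        ∀ k, 1 ≤ k → k ≤ m + 2 → k < #{v | (f v).val < k} := by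
      refine forall_congr' fun k => forall_congr' fun _ => forall_congr' fun hk => ?_
      rw [walk_excess _ _ hk]
      omega
    rw [← hiff]
    exact and_congr_right fun h => avoidsEmptySpot_iff hV hxy h
  have himage : sPF (fun u v : Fin (m + 2 + 1 + 1) =>
        if u = v then 0
        else if (u = x.succ ∧ v = y.succ) ∨ (u = y.succ ∧ v = x.succ) then 0
        else 1) = (fun (f : Fin (m + 2 + 1) → ZMod (m + 2)) v => (f v).val + 1) ''
      (({f | (∀ k, 1 ≤ k → k ≤ m + 2 → 0 < walk (excess univ f) k) ∧ AvoidsEmptySpot x y f} :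
        Finset (Fin (m + 2 + 1) → ZMod (m + 2))) : Set (Fin (m + 2 + 1) → ZMod (m + 2))) := by
    ext P
    simp only [Set.mem_image, coe_filter, mem_univ, true_and, Set.mem_ofPred_eq, hgood]
    constructor
    · intro hP
      have hb : ∀ v, 1 ≤ P v ∧ P v < m + 3 := by
        intro v
        have h1 := dA_complete_sub_edge hxy (mem_univ v)
        have h2 := dA_complete_sub_edge hxy (mem_singleton_self v)
        have h3 := hP.1 v
        obtain ⟨w, hw, h4⟩ := hP.2 {v} (singleton_nonempty v) (by
          intro h
          have := congrArg card h
          simp at this)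
        rw [mem_singleton] at hw
        subst hw
        simp only [mem_univ, not_true_eq_false, and_false, or_self, if_false, card_univ,
          Fintype.card_fin] at h1
        rw [card_singleton] at h2
        omega
      have hval : (fun v => (((P v - 1 : ℕ) : ZMod (m + 2))).val + 1) = P := by
        funext v
        have := hb v
        rw [ZMod.val_natCast_of_lt (by omega)]
        omega
      exact ⟨fun v => ((P v - 1 : ℕ) : ZMod (m + 2)), by rwa [hval], hval⟩
    · rintro ⟨f, hf, rfl⟩
      exact hf
  have hinj : Function.Injective
      (fun (f : Fin (m + 2 + 1) → ZMod (m + 2)) v => (f v).val + 1) := by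
    intro f g hfg
    funext v
    exact ZMod.val_injective _ (Nat.succ_injective (congrFun hfg v))
  rw [himage, Set.ncard_image_of_injective _ hinj, Set.ncard_coe_finset]
  have hcount := card_prime_avoidsEmptySpot (N := m + 2) hV hxy
  refine Nat.eq_of_mul_eq_mul_left (by omega : 0 < m + 2) (hcount.trans ?_)
  simp only [Nat.add_sub_cancel, show m + 2 - 1 = m + 1 by omega, show m + 2 + 1 - 3 = m by omega,
    show m + 2 + 1 - 2 = m + 1 by omega]
  ring
end

section
/- Let n ≥ 3 and a, b ≥ 1 be integers, and let E_1 be the set of all b edges between 1 and n in the complete multigraph K_{n+1}^{a,b}. Then |sPF(K_{n+1}^{a,b} − E_1)| = b^n · |U_n'|, where K_{n+1}^{a,b} − E_1 is the multigraph obtained from K_{n+1}^{a,b} by deleting all edges between 1 and n. -/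
/-- Adjacency matrix of `K_{n+1}^{a,b} − E_1`, the complete multigraph with all `b`
edges between the vertices `1` and `n` deleted. -/
def KabMinusE1 (n a b : ℕ) : Fin (n + 1) → Fin (n + 1) → ℕ := fun i j =>
  if i = j then 0
  else if (i = 1 ∧ j = Fin.last n) ∨ (i = Fin.last n ∧ j = 1) then 0
  else if i = 0 ∨ j = 0 then a
  else b

/-- A rooted labelled tree on the vertex set `Fin n` (representing `[n] = {1,…,n}`),
encoded by its parent function `par` and root `r`. -/
def IsRootedTree {n : ℕ} (par : Fin n → Fin n) (r : Fin n) : Prop :=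
  par r = r ∧ ∀ i, ∃ k, par^[k] i = r

/-- An uprooted tree on `[n]`: a rooted labelled tree whose root is bigger than all its
neighbours. -/
def IsUprooted {n : ℕ} (par : Fin n → Fin n) (r : Fin n) : Prop :=
  IsRootedTree par r ∧ ∀ i, par i = r → i ≠ r → i < r

/-- The set `U_n'` of uprooted trees on `[n]` in which `v1` and `vn` (standing for the
vertices `1` and `n`) are not adjacent. -/
def Unp (n : ℕ) (v1 vn : Fin n) : Set ((Fin n → Fin n) × Fin n) :=
  {p | IsUprooted p.1 p.2 ∧ ¬(p.1 v1 = vn ∨ p.1 vn = v1)}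

/-- Counting a finite set along the fibres of a map to a finite type. -/
lemma ncard_eq_sum_ncard_fiber {α β : Type*} [Fintype β] (s : Set α) (hs : s.Finite)
    (f : α → β) : s.ncard = ∑ y, {x | x ∈ s ∧ f x = y}.ncard := by
  classical
  rw [Set.ncard_eq_toFinset_card s hs,
    Finset.card_eq_sum_card_fiberwise (f := f) (t := Finset.univ) (fun _ _ => by simp)]
  refine Finset.sum_congr rfl fun y _ => ?_
  rw [← Set.ncard_coe_finset]
  congr 1
  ext x
  simp

set_option linter.unusedSectionVars false

section Parking

variable {V : Type*} [Fintype V] [DecidableEq V] (adj : V → V → Prop) [DecidableRel adj]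

/-- The number of neighbours of `i` in `Y`. -/
def degIn (Y : Finset V) (i : V) : ℕ := (Y.filter (adj i)).card

/-- Parking functions on `R` for the graph `adj` with all of `X` burnt at the start,
extended by zero outside `R`. -/
def parkingFunctions (R X : Finset V) : Set (V → ℕ) :=
  {q | (∀ i, i ∉ R → q i = 0) ∧
    ∀ A ⊆ R, A.Nonempty → ∃ i ∈ A, q i < degIn adj ((X ∪ R) \ A) i}

/-- Parent functions of spanning forests of `R ∪ X` in the graph `adj`, with set of roots
`X`, extended by the identity outside `R`. -/
def rootedForests (R X : Finset V) : Set (V → V) :=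
  {p | (∀ i, i ∉ R → p i = i) ∧ (∀ i ∈ R, p i ∈ R ∪ X ∧ adj i (p i)) ∧
    ∀ A ⊆ R, A.Nonempty → ∃ i ∈ A, p i ∉ A}

/-- Functions satisfying the parking condition for every nonempty proper set of vertices. -/
def sphericalFunctions : Set (V → ℕ) :=
  {q | ∀ A : Finset V, A.Nonempty → A ≠ Finset.univ → ∃ i ∈ A, q i < degIn adj Aᶜ i}

lemma degIn_le_card (Y : Finset V) (i : V) : degIn adj Y i ≤ Fintype.card V :=
  Finset.card_le_univ _

lemma degIn_insert {Y : Finset V} {x : V} (hx : x ∉ Y) (i : V) :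
    degIn adj (insert x Y) i = degIn adj Y i + if adj i x then 1 else 0 := by
  unfold degIn
  rw [Finset.filter_insert]
  split_ifs with h
  · rw [Finset.card_insert_of_notMem (by simp [hx])]
  · rfl

lemma degIn_pos {Y : Finset V} {i j : V} (hj : j ∈ Y) (h : adj i j) : 0 < degIn adj Y i :=
  Finset.card_pos.mpr ⟨j, by simp [hj, h]⟩

lemma parkingFunctions_finite (R X : Finset V) : (parkingFunctions adj R X).Finite := by
  refine (Set.finite_Iic (fun _ : V => Fintype.card V)).subset fun q hq i => ?_
  by_cases hi : i ∈ R
  · obtain ⟨j, hj, hlt⟩ := hq.2 {i} (by simpa using hi) (by simp)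
    rw [Finset.mem_singleton] at hj
    subst hj
    exact hlt.le.trans (degIn_le_card adj _ _)
  · simp [hq.1 i hi]

lemma sphericalFunctions_finite [Nontrivial V] : (sphericalFunctions adj).Finite := by
  refine (Set.finite_Iic (fun _ : V => Fintype.card V)).subset fun q hq i => ?_
  obtain ⟨k, hk⟩ := exists_ne i
  obtain ⟨j, hj, hlt⟩ := hq {i} (by simp) (fun h => hk (by
    have := Finset.mem_univ k
    rwa [← h, Finset.mem_singleton] at this))
  rw [Finset.mem_singleton] at hj
  subst hj
  exact hlt.le.trans (degIn_le_card adj _ _)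

lemma ncard_parkingFunctions_fiber {R X S : Finset V} {x : V} (hxR : x ∉ R) (hxX : x ∉ X)
    (hS : S ⊆ R.filter (adj · x)) :
    {q | q ∈ parkingFunctions adj R (insert x X) ∧
      (R.filter fun i => adj i x ∧ q i = 0) = S}.ncard =
      (parkingFunctions adj (R \ S) (X ∪ S)).ncard := by
  have hSR : S ⊆ R := fun i hi => (Finset.mem_filter.mp (hS hi)).1
  have hSx : ∀ i ∈ S, adj i x := fun i hi => (Finset.mem_filter.mp (hS hi)).2
  have key : ∀ A ⊆ R, ∀ i, degIn adj ((insert x X ∪ R) \ A) i =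
      degIn adj ((X ∪ S ∪ (R \ S)) \ A) i + if adj i x then 1 else 0 := by
    intro A hA i
    rw [← degIn_insert adj (by grind)]
    congr 1
    ext j
    grind
  refine Set.ncard_congr (fun q _ i => if i ∈ R ∧ adj i x then q i - 1 else q i) ?_ ?_ ?_
  · rintro q ⟨⟨h0, hq⟩, hz⟩
    have hz' : ∀ i, i ∈ S ↔ i ∈ R ∧ adj i x ∧ q i = 0 := fun i => by
      rw [← hz, Finset.mem_filter]
    refine ⟨fun i hi => ?_, fun A hA hne => ?_⟩
    · have := hz' i
      have := h0 i
      grind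
    · have hAR : A ⊆ R := hA.trans Finset.sdiff_subset
      obtain ⟨i, hi, hlt⟩ := hq A hAR hne
      refine ⟨i, hi, ?_⟩
      rw [key A hAR] at hlt
      have := hz' i
      have := hA hi
      grind
  · rintro q q' ⟨⟨h0, _⟩, hz⟩ ⟨⟨h0', _⟩, hz'⟩ h
    funext i
    have := congrFun h i
    have h1 : i ∈ S ↔ i ∈ R ∧ adj i x ∧ q i = 0 := by rw [← hz, Finset.mem_filter]
    have h2 : i ∈ S ↔ i ∈ R ∧ adj i x ∧ q' i = 0 := by rw [← hz', Finset.mem_filter]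
    grind
  · rintro q ⟨h0, hq⟩
    refine ⟨fun i => if i ∈ R \ S ∧ adj i x then q i + 1 else q i, ⟨⟨?_, ?_⟩, ?_⟩, ?_⟩
    · intro i hi
      have := h0 i
      grind
    · intro A hA hne
      by_cases hAS : ∃ i ∈ A, i ∈ S
      · obtain ⟨i, hi, hiS⟩ := hAS
        refine ⟨i, hi, ?_⟩
        rw [key A hA]
        have := h0 i
        have := hSx i hiS
        grind
      · push Not at hAS
        obtain ⟨i, hi, hlt⟩ := hq A (fun j hj => by
          have := hAS j hj
          have := hA hj
          grind) hne
        refine ⟨i, hi, ?_⟩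
        rw [key A hA]
        grind
    · ext i
      have := h0 i
      have := hSx i
      have := @hSR i
      grind
    · funext i
      have := h0 i
      grind

lemma ncard_rootedForests_fiber {R X S : Finset V} {x : V} (hxR : x ∉ R) (hxX : x ∉ X)
    (hS : S ⊆ R.filter (adj · x)) :
    {p | p ∈ rootedForests adj R (insert x X) ∧ (R.filter fun i => p i = x) = S}.ncard =
      (rootedForests adj (R \ S) (X ∪ S)).ncard := by
  have hSR : S ⊆ R := fun i hi => (Finset.mem_filter.mp (hS hi)).1
  have hSx : ∀ i ∈ S, adj i x := fun i hi => (Finset.mem_filter.mp (hS hi)).2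
  refine Set.ncard_congr (fun p _ i => if i ∈ S then i else p i) ?_ ?_ ?_
  · rintro p ⟨⟨h0, h1, hp⟩, hz⟩
    have hz' : ∀ i, i ∈ S ↔ i ∈ R ∧ p i = x := fun i => by
      rw [← hz, Finset.mem_filter]
    refine ⟨fun i hi => ?_, fun i hi => ?_, fun A hA hne => ?_⟩
    · have := h0 i
      grind
    · have := h1 i
      have := hz' i
      grind
    · obtain ⟨i, hi, hlt⟩ := hp A (hA.trans Finset.sdiff_subset) hne
      have := hA hi
      exact ⟨i, hi, by grind⟩
  · rintro p p' ⟨_, hz⟩ ⟨_, hz'⟩ h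
    funext i
    have := congrFun h i
    have h1 : i ∈ S ↔ i ∈ R ∧ p i = x := by rw [← hz, Finset.mem_filter]
    have h2 : i ∈ S ↔ i ∈ R ∧ p' i = x := by rw [← hz', Finset.mem_filter]
    grind
  · rintro p ⟨h0, h1, hp⟩
    refine ⟨fun i => if i ∈ S then x else p i, ⟨⟨?_, ?_, ?_⟩, ?_⟩, ?_⟩
    · intro i hi
      have := h0 i
      grind
    · intro i hi
      have := h1 i
      have := hSx i
      grind
    · intro A hA hne
      by_cases hAS : ∃ i ∈ A, i ∈ S
      · obtain ⟨i, hi, hiS⟩ := hAS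
        exact ⟨i, hi, by grind⟩
      · push Not at hAS
        obtain ⟨i, hi, hlt⟩ := hp A (fun j hj => by
          have := hAS j hj
          have := hA hj
          grind) hne
        exact ⟨i, hi, by grind⟩
    · ext i
      have := h1 i
      have := @hSR i
      grind
    · funext i
      have := h0 i
      grind

/-- Recursion for parking functions, by burning the edges at one burnt vertex. -/
lemma ncard_parkingFunctions_insert {R X : Finset V} {x : V} (hxR : x ∉ R) (hxX : x ∉ X) :
    (parkingFunctions adj R (insert x X)).ncard =
      ∑ S ∈ (R.filter (adj · x)).powerset, (parkingFunctions adj (R \ S) (X ∪ S)).ncard := by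
  rw [ncard_eq_sum_ncard_fiber _ (parkingFunctions_finite adj _ _)
    (fun q => R.filter fun i => adj i x ∧ q i = 0),
    ← Finset.sum_subset (Finset.subset_univ (R.filter (adj · x)).powerset)]
  · exact Finset.sum_congr rfl fun S hS =>
      ncard_parkingFunctions_fiber adj hxR hxX (Finset.mem_powerset.mp hS)
  · intro S _ hS
    rw [Finset.mem_powerset] at hS
    convert Set.ncard_empty (V → ℕ)
    ext q
    simp only [Set.mem_ofPred_eq, Set.mem_empty_iff_false, iff_false, not_and]
    rintro - rfl
    exact hS fun i => by simp +contextual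

/-- Recursion for forests, by removing one root. -/
lemma ncard_rootedForests_insert {R X : Finset V} {x : V} (hxR : x ∉ R) (hxX : x ∉ X) :
    (rootedForests adj R (insert x X)).ncard =
      ∑ S ∈ (R.filter (adj · x)).powerset, (rootedForests adj (R \ S) (X ∪ S)).ncard := by
  rw [ncard_eq_sum_ncard_fiber _ (Set.toFinite _) (fun p => R.filter fun i => p i = x),
    ← Finset.sum_subset (Finset.subset_univ (R.filter (adj · x)).powerset)]
  · exact Finset.sum_congr rfl fun S hS =>
      ncard_rootedForests_fiber adj hxR hxX (Finset.mem_powerset.mp hS)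
  · intro S _ hS
    rw [Finset.mem_powerset] at hS
    convert Set.ncard_empty (V → V)
    ext p
    simp only [Set.mem_ofPred_eq, Set.mem_empty_iff_false, iff_false, not_and]
    rintro ⟨_, h1, _⟩ rfl
    refine hS fun i hi => ?_
    have := h1 i
    grind

lemma rootedForests_empty_right {R : Finset V} (hR : R.Nonempty) :
    rootedForests adj R ∅ = ∅ := by
  ext p
  simp only [Set.mem_empty_iff_false, iff_false]
  rintro ⟨_, h1, h2⟩
  obtain ⟨i, hi, h⟩ := h2 R subset_rfl hR
  have := h1 i hi
  grind

lemma parkingFunctions_empty_right {R : Finset V} (hR : R.Nonempty) :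
    parkingFunctions adj R ∅ = ∅ := by
  ext q
  simp only [Set.mem_empty_iff_false, iff_false]
  rintro ⟨_, h2⟩
  obtain ⟨i, hi, h⟩ := h2 R subset_rfl hR
  simp [degIn] at h

/-- Parking functions and spanning forests are equinumerous. -/
theorem ncard_parkingFunctions_eq_rootedForests (R X : Finset V) (h : Disjoint R X) :
    (parkingFunctions adj R X).ncard = (rootedForests adj R X).ncard := by
  induction hm : R.card + X.card generalizing R X with
  | zero =>
    obtain ⟨hR, hX⟩ : R = ∅ ∧ X = ∅ := by simpa using hm
    subst hR hX
    have h1 : parkingFunctions adj ∅ ∅ = {fun _ => 0} := by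
      ext q
      simp +contextual [parkingFunctions, funext_iff, Finset.subset_empty]
    have h2 : rootedForests adj ∅ ∅ = {id} := by
      ext q
      simp +contextual [rootedForests, funext_iff, Finset.subset_empty]
    rw [h1, h2, Set.ncard_singleton, Set.ncard_singleton]
  | succ m ih =>
    rcases X.eq_empty_or_nonempty with rfl | ⟨x, hx⟩
    · have hR : R.Nonempty := Finset.card_pos.mp (by simp at hm; omega)
      rw [parkingFunctions_empty_right adj hR, rootedForests_empty_right adj hR]
      simp
    · obtain ⟨X, hxX, rfl⟩ : ∃ Y, x ∉ Y ∧ insert x Y = X :=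
        ⟨X.erase x, Finset.notMem_erase _ _, Finset.insert_erase hx⟩
      rw [Finset.disjoint_insert_right] at h
      rw [ncard_parkingFunctions_insert adj h.1 hxX, ncard_rootedForests_insert adj h.1 hxX]
      refine Finset.sum_congr rfl fun S hS => ?_
      have hSR : S ⊆ R := (Finset.mem_powerset.mp hS).trans (Finset.filter_subset _ _)
      have hd := h.2
      refine ih _ _ ?_ ?_
      · rw [Finset.disjoint_left] at hd ⊢
        grind
      · rw [Finset.card_insert_of_notMem hxX] at hm
        rw [Finset.card_union_of_disjoint (hd.symm.mono_right hSR),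
          Finset.card_sdiff_of_subset hSR]
        have := Finset.card_le_card hSR
        omega

lemma ncard_sphericalFunctions_fiber {S : Finset V} {ρ : V} (hρ : ρ ∈ S)
    (hin : ∀ i, i ≠ ρ → adj i ρ) (hout : ∀ i, i ≠ ρ → adj ρ i) :
    {q | q ∈ sphericalFunctions adj ∧ (Finset.univ.filter fun i => q i = 0) = S}.ncard =
      (parkingFunctions adj Sᶜ (S.erase ρ)).ncard := by
  have key : ∀ A ⊆ Sᶜ, ∀ i ∈ A, degIn adj Aᶜ i =
      degIn adj ((S.erase ρ ∪ Sᶜ) \ A) i + 1 := by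
    intro A hA i hi
    have hρA : ρ ∉ A := fun h => by simpa [hρ] using hA h
    have h1 : adj i ρ := hin i (by grind)
    rw [← if_pos (c := adj i ρ) (t := 1) (e := 0) h1,
      ← degIn_insert adj (by grind [Finset.mem_compl])]
    congr 1
    ext j
    by_cases j ∈ S <;> grind [Finset.mem_compl]
  refine Set.ncard_congr (fun q _ i => q i - 1) ?_ ?_ ?_
  · rintro q ⟨hq, hz⟩
    have hz' : ∀ i, i ∈ S ↔ q i = 0 := fun i => by simp [← hz]
    refine ⟨fun i hi => ?_, fun A hA hne => ?_⟩
    · have := hz' i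
      grind [Finset.mem_compl]
    · have hρA : ρ ∉ A := fun h => by simpa [hρ] using hA h
      obtain ⟨i, hi, hlt⟩ := hq A hne (fun h => hρA (h ▸ Finset.mem_univ _))
      refine ⟨i, hi, ?_⟩
      rw [key A hA i hi] at hlt
      have := hz' i
      have := hA hi
      grind [Finset.mem_compl]
  · rintro q q' ⟨_, hz⟩ ⟨_, hz'⟩ h
    funext i
    have := congrFun h i
    have h1 : i ∈ S ↔ q i = 0 := by simp [← hz]
    have h2 : i ∈ S ↔ q' i = 0 := by simp [← hz']
    grind
  · rintro q ⟨h0, hq⟩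
    refine ⟨fun i => if i ∈ S then 0 else q i + 1, ⟨?_, ?_⟩, ?_⟩
    · intro A hne hA
      by_cases hρA : ρ ∈ A
      · obtain ⟨j, hj⟩ : ∃ j, j ∉ A := by
          by_contra! h
          exact hA (Finset.eq_univ_iff_forall.mpr h)
        refine ⟨ρ, hρA, ?_⟩
        simpa [hρ] using degIn_pos adj (Finset.mem_compl.mpr hj) (hout j (by grind))
      · by_cases hAS : ∃ i ∈ A, i ∈ S
        · obtain ⟨i, hi, hiS⟩ := hAS
          refine ⟨i, hi, ?_⟩
          simpa [hiS] using degIn_pos adj (Finset.mem_compl.mpr hρA) (hin i (by grind))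
        · push Not at hAS
          have hA' : A ⊆ Sᶜ := fun j hj => by simpa using hAS j hj
          obtain ⟨i, hi, hlt⟩ := hq A hA' hne
          refine ⟨i, hi, ?_⟩
          rw [key A hA' i hi]
          grind
    · ext i
      simp
    · funext i
      have := h0 i
      grind [Finset.mem_compl]

/-- The zero set of a spherical function meets the neighbourhood of every vertex. -/
lemma sphericalFunctions_fiber_eq_empty {S : Finset V} {v : V} [Nontrivial V]
    (hS : ∀ i ∈ S, i ≠ v → ¬ adj i v) :
    {q | q ∈ sphericalFunctions adj ∧ (Finset.univ.filter fun i => q i = 0) = S} = ∅ := by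
  ext q
  simp only [Set.mem_ofPred_eq, Set.mem_empty_iff_false, iff_false, not_and]
  rintro hq rfl
  obtain ⟨k, hk⟩ := exists_ne v
  obtain ⟨i, hi, hlt⟩ := hq {v}ᶜ ⟨k, by simpa using hk⟩ (fun h => by
    have := Finset.mem_univ v
    rw [← h] at this
    simp at this)
  have hiv : i ≠ v := by simpa using hi
  have hc : degIn adj {v}ᶜᶜ i = if adj i v then 1 else 0 := by
    rw [compl_compl]
    unfold degIn
    rw [Finset.filter_singleton]
    split_ifs <;> simp
  rw [hc] at hlt
  have := hS i
  grind

end Parking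

/-- The complete graph on `V` with the edge between `u` and `w` removed. -/
def AdjMinusEdge {V : Type*} (u w : V) (i j : V) : Prop :=
  i ≠ j ∧ ¬ ((i = u ∧ j = w) ∨ (i = w ∧ j = u))

instance {V : Type*} [DecidableEq V] (u w : V) : DecidableRel (AdjMinusEdge u w) :=
  fun i j => inferInstanceAs (Decidable (i ≠ j ∧ ¬ ((i = u ∧ j = w) ∨ (i = w ∧ j = u))))

section MinusEdge

variable {V : Type*} [Fintype V] [DecidableEq V]

/-- Trading the root `ρ` for the root `w`, which is not adjacent to `u`. -/
lemma ncard_rootedForests_exchange {u w ρ : V} (huw : u ≠ w) {R Y : Finset V}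
    (hρu : ρ ≠ u) (hρw : ρ ≠ w) (huR : u ∉ R) (hwR : w ∉ R) (hρR : ρ ∉ R)
    (hwY : w ∉ Y) (hρY : ρ ∉ Y) :
    (rootedForests (AdjMinusEdge u w) (insert u R) (insert w Y)).ncard +
      (rootedForests (AdjMinusEdge u w) R (insert w (insert u Y))).ncard =
      (rootedForests (AdjMinusEdge u w) (insert u R) (insert ρ Y)).ncard := by
  rw [ncard_rootedForests_insert _ (by grind) hwY, ncard_rootedForests_insert _ hwR (by grind),
    ncard_rootedForests_insert _ (by grind) hρY]
  have h1 : (insert u R).filter (AdjMinusEdge u w · w) = R := by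
    ext i; simp only [AdjMinusEdge]; grind
  have h2 : R.filter (AdjMinusEdge u w · w) = R := by
    ext i; simp only [Finset.mem_filter, AdjMinusEdge]; grind
  have h3 : (insert u R).filter (AdjMinusEdge u w · ρ) = insert u R := by
    ext i; simp only [AdjMinusEdge]; grind
  rw [h1, h2, h3, Finset.sum_powerset_insert huR]
  congr 1
  refine Finset.sum_congr rfl fun S hS => ?_
  rw [Finset.mem_powerset] at hS
  congr 2 <;> grind

end MinusEdge

lemma isRootedTree_iff {n : ℕ} (p : Fin n → Fin n) (r : Fin n) :
    IsRootedTree p r ↔ p r = r ∧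
      ∀ A : Finset (Fin n), r ∉ A → A.Nonempty → ∃ i ∈ A, p i ∉ A := by
  refine and_congr_right fun hr => ⟨fun h A hrA ⟨i, hi⟩ => ?_, fun h i => ?_⟩
  · by_contra! hA
    obtain ⟨k, hk⟩ := h i
    have : ∀ k, p^[k] i ∈ A := fun k => by
      induction k with
      | zero => exact hi
      | succ k ih => rw [Function.iterate_succ_apply']; exact hA _ ih
    exact hrA (hk ▸ this k)
  · classical
    by_contra hi
    obtain ⟨j, hj, hpj⟩ := h (Finset.univ.filter fun i => ¬ ∃ k, p^[k] i = r)
      (by simpa using ⟨0, rfl⟩) ⟨i, by simpa using hi⟩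
    simp only [Finset.mem_filter, Finset.mem_univ, true_and, not_not] at hj hpj
    obtain ⟨k, hk⟩ := hpj
    exact hj ⟨k + 1, hk⟩

section Uprooted

variable {n : ℕ} {u w : Fin n}

lemma ncard_Unp_fiber {S : Finset (Fin n)} {r : Fin n} (hr : r ∈ S) (hmax : ∀ i ∈ S, i ≤ r)
    (hS : ¬ (u ∈ S ∧ w ∈ S)) :
    {x | x ∈ Unp n u w ∧ (Finset.univ.filter fun i => x.1 i = x.2) = S}.ncard =
      (rootedForests (AdjMinusEdge u w) Sᶜ (S.erase r)).ncard := by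
  have root : ∀ p : Fin n → Fin n, ∀ s, (p, s) ∈ Unp n u w →
      (Finset.univ.filter fun i => p i = s) = S → s = r := by
    rintro p s ⟨⟨hT, hup⟩, _⟩ hz
    have h1 : s ∈ S := by simpa [← hz] using hT.1
    have h2 : p r = s := by simpa [← hz] using hr
    by_contra hne
    exact absurd (hup r h2 (Ne.symm hne)) (not_lt.mpr (hmax s h1))
  refine Set.ncard_congr (fun x _ i => if i ∈ S then i else x.1 i) ?_ ?_ ?_
  · rintro ⟨p, s⟩ ⟨hU, hz⟩
    obtain rfl := root p s hU hz
    obtain ⟨⟨hT, hup⟩, hne⟩ := hU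
    have hz' : ∀ i, i ∈ S ↔ p i = s := fun i => by simp [← hz]
    rw [isRootedTree_iff] at hT
    simp only at hne
    refine ⟨fun i hi => by grind [Finset.mem_compl], fun i hi => ?_, fun A hA hne' => ?_⟩
    · have hiS : i ∉ S := by simpa using hi
      have := hz' i
      have hpi : p i ≠ i := fun h => by
        obtain ⟨j, hj, hpj⟩ := hT.2 {i} (by grind) (by simp)
        grind
      simp only [hiS, if_false, AdjMinusEdge]
      grind [Finset.mem_compl]
    · obtain ⟨i, hi, h⟩ := hT.2 A (fun h => by simpa [hr] using hA h) hne'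
      have := hA hi
      exact ⟨i, hi, by grind [Finset.mem_compl]⟩
  · rintro ⟨p, s⟩ ⟨p', s'⟩ ⟨hU, hz⟩ ⟨hU', hz'⟩ h
    obtain rfl := root p s hU hz
    obtain rfl := root p' s' hU' hz'
    refine Prod.ext (funext fun i => ?_) rfl
    have := congrFun h i
    have h1 : i ∈ S ↔ p i = s' := by simp [← hz]
    have h2 : i ∈ S ↔ p' i = s' := by simp [← hz']
    grind
  · rintro p ⟨h0, h1, hp⟩
    refine ⟨(fun i => if i ∈ S then r else p i, r), ⟨⟨⟨?_, ?_⟩, ?_⟩, ?_⟩, ?_⟩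
    · rw [isRootedTree_iff]
      refine ⟨by simp [hr], fun A hrA hne => ?_⟩
      by_cases hAS : ∃ i ∈ A, i ∈ S
      · obtain ⟨i, hi, hiS⟩ := hAS
        exact ⟨i, hi, by grind⟩
      · push Not at hAS
        obtain ⟨i, hi, h⟩ := hp A (fun j hj => by simpa using hAS j hj) hne
        exact ⟨i, hi, by grind⟩
    · intro i hi hne
      have hiS : i ∈ S := by
        have := h1 i
        grind [Finset.mem_compl]
      exact lt_of_le_of_ne (hmax i hiS) hne
    · have hu := h1 u
      have hw := h1 w
      simp only [AdjMinusEdge] at hu hw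
      grind [Finset.mem_compl]
    · ext i
      have := h1 i
      grind [Finset.mem_compl]
    · funext i
      have := h0 i
      grind [Finset.mem_compl]

lemma Unp_fiber_eq_empty_of_mem {S : Finset (Fin n)} (hu : u ∈ S) (hw : w ∈ S)
    (hmax : ∀ i, i ≤ w) :
    {x | x ∈ Unp n u w ∧ (Finset.univ.filter fun i => x.1 i = x.2) = S} = ∅ := by
  ext ⟨p, s⟩
  simp only [Set.mem_ofPred_eq, Set.mem_empty_iff_false, iff_false, not_and]
  rintro ⟨⟨hT, hup⟩, hne⟩ rfl
  have h1 : p u = s := by simpa using hu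
  have h2 : p w = s := by simpa using hw
  by_cases h : w = s
  · exact hne (Or.inl (h1.trans h.symm))
  · exact absurd (hup w h2 h) (not_lt.mpr (hmax s))

lemma Unp_fiber_empty :
    {x | x ∈ Unp n u w ∧ (Finset.univ.filter fun i => x.1 i = x.2) = ∅} = ∅ := by
  ext ⟨p, s⟩
  simp only [Set.mem_ofPred_eq, Set.mem_empty_iff_false, iff_false, not_and]
  rintro ⟨⟨hT, hup⟩, hne⟩ h
  have : s ∈ (∅ : Finset (Fin n)) := by
    rw [← h]
    simpa using hT.1
  simp at this

/-- Spherical functions of the complete graph without its edge between the smallest and the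
largest vertex are equinumerous with the uprooted trees avoiding this edge. -/
theorem ncard_sphericalFunctions_eq_ncard_Unp (huw : u ≠ w) (hmin : ∀ i, u ≤ i)
    (hmax : ∀ i, i ≤ w) :
    (sphericalFunctions (AdjMinusEdge u w)).ncard = (Unp n u w).ncard := by
  have : Nontrivial (Fin n) := ⟨u, w, huw⟩
  set W : Finset (Fin n) := Finset.univ \ {u, w} with hW
  have huniv : (Finset.univ : Finset (Finset (Fin n))) = (insert u (insert w W)).powerset := by
    ext S
    simp only [Finset.mem_univ, Finset.mem_powerset, true_iff]
    intro i _
    grind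
  rw [ncard_eq_sum_ncard_fiber _ (sphericalFunctions_finite _)
      (fun q => Finset.univ.filter fun i => q i = 0),
    ncard_eq_sum_ncard_fiber _ (Set.toFinite (Unp n u w))
      (fun x => Finset.univ.filter fun i => x.1 i = x.2), huniv]
  rw [Finset.sum_powerset_insert (by grind), Finset.sum_powerset_insert (by grind),
    Finset.sum_powerset_insert (by grind), Finset.sum_powerset_insert (by grind),
    Finset.sum_powerset_insert (by grind), Finset.sum_powerset_insert (by grind)]
  simp only [← Finset.sum_add_distrib]
  refine Finset.sum_congr rfl fun T hT => ?_
  rw [Finset.mem_powerset] at hT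
  have huT : u ∉ T := fun h => by simpa [hW] using hT h
  have hwT : w ∉ T := fun h => by simpa [hW] using hT h
  rw [Unp_fiber_eq_empty_of_mem (S := insert u (insert w T)) (by simp) (by simp) hmax]
  rcases T.eq_empty_or_nonempty with rfl | hne
  · have hadj : ∀ i ∈ ({u, w} : Finset (Fin n)), i ≠ u → ¬ AdjMinusEdge u w i u := by
      intro i hi; simp only [AdjMinusEdge]; grind
    rw [Unp_fiber_empty, sphericalFunctions_fiber_eq_empty (S := ∅) (v := u) _ (by grind),
      sphericalFunctions_fiber_eq_empty (S := insert w ∅) (v := u) _ (by grind),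
      sphericalFunctions_fiber_eq_empty (S := insert u ∅) (v := u) _ (by grind),
      sphericalFunctions_fiber_eq_empty (S := insert u (insert w ∅)) (v := u) _ (by grind),
      ncard_Unp_fiber (r := w) (by simp) (by grind) (by grind),
      ncard_Unp_fiber (r := u) (by simp) (by grind) (by grind)]
    simp only [insert_empty_eq, Finset.erase_singleton]
    rw [rootedForests_empty_right _ ⟨u, by simpa using huw⟩,
      rootedForests_empty_right _ ⟨w, by simpa using huw.symm⟩]
    simp only [Set.ncard_empty]
  · obtain ⟨ρ, hρ, hρmax⟩ : ∃ ρ ∈ T, ∀ i ∈ T, i ≤ ρ :=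
      ⟨T.max' hne, T.max'_mem hne, fun i hi => T.le_max' i hi⟩
    have hρu : ρ ≠ u := by grind
    have hρw : ρ ≠ w := by grind
    have hin : ∀ i, i ≠ ρ → AdjMinusEdge u w i ρ := by
      intro i hi; simp only [AdjMinusEdge]; grind
    have hout : ∀ i, i ≠ ρ → AdjMinusEdge u w ρ i := by
      intro i hi; simp only [AdjMinusEdge]; grind
    have count : ∀ S : Finset (Fin n), ρ ∈ S →
        {q | q ∈ sphericalFunctions (AdjMinusEdge u w) ∧
          (Finset.univ.filter fun i => q i = 0) = S}.ncard =
        (rootedForests (AdjMinusEdge u w) Sᶜ (S.erase ρ)).ncard := by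
      intro S hρS
      rw [ncard_sphericalFunctions_fiber _ hρS hin hout,
        ncard_parkingFunctions_eq_rootedForests]
      rw [Finset.disjoint_left]
      intro i hi hi'
      exact (Finset.mem_compl.mp hi) (Finset.mem_of_mem_erase hi')
    rw [count T hρ, count _ (by grind), count _ (by grind), count _ (by grind),
      ncard_Unp_fiber (r := ρ) hρ hρmax (by grind),
      ncard_Unp_fiber (r := w) (by simp) (by grind) (by grind),
      ncard_Unp_fiber (S := insert u T) (r := ρ) (by grind) (by grind) (by grind)]
    have h := ncard_rootedForests_exchange huw (R := W \ T) (Y := T.erase ρ) hρu hρw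
      (by grind) (by grind) (by grind) (by grind) (by grind)
    have e1 : (insert w T)ᶜ = insert u (W \ T) := by ext i; simp [hW]; grind
    have e2 : (insert w T).erase ρ = insert w (T.erase ρ) := by grind
    have e3 : (insert u (insert w T))ᶜ = W \ T := by ext i; simp [hW]; grind
    have e4 : (insert u (insert w T)).erase ρ = insert w (insert u (T.erase ρ)) := by grind
    have e5 : (insert w T).erase w = insert ρ (T.erase ρ) := by grind
    rw [e1, e2, e3, e4, e5, ← h, Set.ncard_empty]
    ring

end Uprooted

section Scaling

variable {n : ℕ}

lemma KabMinusE1_succ_zero (hn : 3 ≤ n) (a b : ℕ) (i : Fin n) :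
    KabMinusE1 n a b i.succ 0 = a := by
  obtain ⟨n, rfl⟩ : ∃ m, n = m + 3 := ⟨n - 3, by omega⟩
  rw [KabMinusE1, if_neg i.succ_ne_zero, if_neg, if_pos (Or.inr rfl)]
  rintro (⟨-, h⟩ | ⟨-, h⟩)
  · exact (Fin.last_pos.ne h).elim
  · exact zero_ne_one h

lemma KabMinusE1_succ_succ (hn : 3 ≤ n) (a b : ℕ) {i j : Fin n} (hij : i ≠ j) :
    KabMinusE1 n a b i.succ j.succ =
      if AdjMinusEdge ⟨0, by omega⟩ ⟨n - 1, by omega⟩ i j then b else 0 := by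
  obtain ⟨n, rfl⟩ : ∃ m, n = m + 3 := ⟨n - 3, by omega⟩
  have h1 : ∀ k : Fin (n + 3), k.succ = 1 ↔ k = ⟨0, by omega⟩ := fun k => by
    rw [Fin.ext_iff, Fin.ext_iff, Fin.val_succ, Fin.val_one]
    simp
  have h2 : ∀ k : Fin (n + 3),
      k.succ = Fin.last (n + 3) ↔ k = ⟨n + 3 - 1, by omega⟩ := fun k => by
    rw [Fin.ext_iff, Fin.ext_iff, Fin.val_succ, Fin.val_last]
    simp only
    omega
  rw [KabMinusE1, if_neg (by simpa using hij)]
  simp only [h1, h2, AdjMinusEdge, Fin.succ_ne_zero]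
  grind

lemma dA_KabMinusE1_univ (hn : 3 ≤ n) (a b : ℕ) (i : Fin n) :
    dA (KabMinusE1 n a b) Finset.univ i = a := by
  simp [dA, KabMinusE1_succ_zero hn]

lemma dA_KabMinusE1 (hn : 3 ≤ n) (a b : ℕ) {A : Finset (Fin n)} {i : Fin n} (hi : i ∈ A) :
    dA (KabMinusE1 n a b) A i =
      a + b * degIn (AdjMinusEdge ⟨0, by omega⟩ ⟨n - 1, by omega⟩) Aᶜ i := by
  rw [dA, KabMinusE1_succ_zero hn, degIn, Finset.card_filter, Finset.mul_sum]
  congr 1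
  refine Finset.sum_congr rfl fun j hj => ?_
  rw [KabMinusE1_succ_succ hn a b (by rintro rfl; exact Finset.mem_compl.mp hj hi)]
  simp

lemma ncard_sPF_KabMinusE1 (hn : 3 ≤ n) (a : ℕ) {b : ℕ} (hb : 1 ≤ b) :
    (sPF (KabMinusE1 n a b)).ncard = b ^ n *
      (sphericalFunctions
        (AdjMinusEdge (⟨0, by omega⟩ : Fin n) ⟨n - 1, by omega⟩)).ncard := by
  set H := AdjMinusEdge (⟨0, by omega⟩ : Fin n) ⟨n - 1, by omega⟩ with hH
  have key : ∀ q r d : ℕ, r < b → (a + b * q + r < a + b * d ↔ q < d) := by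
    intro q r d hr
    constructor
    · intro h
      by_contra! hqd
      have := Nat.mul_le_mul_left b hqd
      omega
    · intro h
      have := Nat.mul_le_mul_left b (Nat.succ_le_of_lt h)
      rw [Nat.mul_succ] at this
      omega
  let f : (Fin n → Fin b) × (Fin n → ℕ) → Fin n → ℕ := fun x i => a + b * x.2 i + x.1 i
  have hf : Function.Injective f := by
    rintro ⟨r, q⟩ ⟨r', q'⟩ h
    have h1 : ∀ i, b * q i + r i = b * q' i + r' i := fun i => by
      have := congrFun h i
      simp only [f] at this
      omega
    have h2 : ∀ i, q i = q' i := fun i => by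
      have := congrArg (· / b) (h1 i)
      simpa [Nat.mul_add_div hb, Nat.div_eq_of_lt (r i).isLt,
        Nat.div_eq_of_lt (r' i).isLt] using this
    refine Prod.ext (funext fun i => Fin.ext ?_) (funext h2)
    have := h1 i
    rw [h2 i] at this
    exact Nat.add_left_cancel this
  have himage : sPF (KabMinusE1 n a b) =
      f '' ((Set.univ : Set (Fin n → Fin b)) ×ˢ sphericalFunctions H) := by
    ext P
    constructor
    · rintro ⟨h1, h2⟩
      have hP : f (fun i => ⟨(P i - a) % b, Nat.mod_lt _ hb⟩, fun i => (P i - a) / b) = P := by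
        funext i
        have := h1 i
        rw [dA_KabMinusE1_univ hn] at this
        have := Nat.div_add_mod (P i - a) b
        simp only [f]
        omega
      refine ⟨_, ⟨trivial, fun A hne hA => ?_⟩, hP⟩
      obtain ⟨i, hi, hlt⟩ := h2 A hne hA
      rw [← hP, dA_KabMinusE1 hn a b hi] at hlt
      exact ⟨i, hi, (key _ _ _ (Nat.mod_lt _ hb)).mp hlt⟩
    · rintro ⟨⟨r, q⟩, ⟨-, hq⟩, rfl⟩
      refine ⟨fun i => ?_, fun A hne hA => ?_⟩
      · rw [dA_KabMinusE1_univ hn]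
        simp only [f]
        omega
      · obtain ⟨i, hi, hlt⟩ := hq A hne hA
        refine ⟨i, hi, ?_⟩
        rw [dA_KabMinusE1 hn a b hi]
        exact (key _ _ _ (r i).isLt).mpr hlt
  rw [himage, Set.ncard_image_of_injective _ hf, Set.ncard_prod, Set.ncard_univ]
  congr 1
  simp

end Scaling

/-- `|sPF(K_{n+1}^{a,b} − E_1)| = b^n · |U_n'|`. -/
theorem stmt15 (n a b : ℕ) (hn : 3 ≤ n) (ha : 1 ≤ a) (hb : 1 ≤ b) :
    (sPF (KabMinusE1 n a b)).ncard =
      b ^ n * (Unp n ⟨0, by omega⟩ ⟨n - 1, by omega⟩).ncard := by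
  rw [ncard_sPF_KabMinusE1 hn a hb, ncard_sphericalFunctions_eq_ncard_Unp]
  · simp only [ne_eq, Fin.mk.injEq]
    omega
  · intro i
    simp [Fin.le_def]
  · intro i
    simp only [Fin.le_def]
    omega
end

section
/- For every integer n ≥ 1 and every rational number b, the determinant of the n×n Steck matrix Λ(x+(n−1)b, x+(n−2)b, …, x+b, x) over ℚ[x] (whose (i,j) entry is (x+(i−1)b)^{j−i+1}/(j−i+1)! for j−i+1 ≥ 0 and 0 for i > j+1) equals x(x+nb)^{n−1}/n!. -/
open Polynomial

/-- The determinant of a Hessenberg matrix with ones below the diagonal, computed from a vector `c`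
with `c 0 = 1` that is orthogonal to every column of the infinite matrix. -/
theorem det_hessenberg_of_sum_eq_zero {R : Type*} [CommRing R] (f : ℕ → ℕ → R) (c : ℕ → R)
    (hc : c 0 = 1) (hlow : ∀ i j, j + 1 < i → f i j = 0) (hsub : ∀ j, f (j + 1) j = 1)
    (hsum : ∀ m, ∑ i ∈ Finset.range (m + 2), c i * f i m = 0) (n : ℕ) :
    Matrix.det (Matrix.of fun i j : Fin n => f i j) = (-1) ^ n * c n := by
  cases n with
  | zero => simp [hc]
  | succ N =>
    set A : Matrix (Fin (N + 1)) (Fin (N + 1)) R := Matrix.of fun i j => f i j with hA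
    have hrow : ∀ j : Fin (N + 1), (∑ k : Fin (N + 1), c k • A k) j =
        if j = Fin.last N then -c (N + 1) else 0 := by
      intro j
      have hval : (∑ k : Fin (N + 1), c k • A k) j = ∑ i ∈ Finset.range (N + 1), c i * f i j := by
        rw [Finset.sum_range, Finset.sum_apply]
        simp [hA]
      rw [hval]
      split_ifs with hj
      · subst hj
        have h := hsum N
        rw [Finset.sum_range_succ, hsub, mul_one] at h
        simpa using eq_neg_of_add_eq_zero_left h
      · have hlt : (j : ℕ) < N := Fin.val_lt_last hj
        rw [← hsum j]
        symm
        apply Finset.sum_subset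
        · intro i hi
          simp only [Finset.mem_range] at hi ⊢
          omega
        · intro i _ hi
          simp only [Finset.mem_range, not_lt] at hi
          rw [hlow i j (by omega), mul_zero]
    have hdet := Matrix.det_updateRow_sum A 0 fun k => c (k : ℕ)
    simp only [Fin.val_zero, hc, one_smul] at hdet
    rw [← hdet, Matrix.det_succ_row_zero, Finset.sum_eq_single (Fin.last N)]
    · have htri : ((A.updateRow 0 (∑ k : Fin (N + 1), c k • A k)).submatrix Fin.succ
          (Fin.last N).succAbove).det = 1 := by
        have hent : (A.updateRow 0 (∑ k : Fin (N + 1), c k • A k)).submatrix Fin.succ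
            (Fin.last N).succAbove = Matrix.of fun i j : Fin N => f (i + 1) j := by
          ext i j
          simp [hA]
        rw [hent, Matrix.det_of_isUpperTriangular]
        · simp [hsub]
        · intro i j hij
          have : (j : ℕ) < i := hij
          exact hlow _ _ (by omega)
      rw [htri, Matrix.updateRow_self, hrow]
      simp [pow_succ]
    · intro j _ hj
      rw [Matrix.updateRow_self, hrow, if_neg hj]
      simp
    · simp

theorem sum_neg_one_pow_choose_mul_linear_pow {R : Type*} [CommRing R] (x b : R) (m : ℕ) :
    ∑ i ∈ Finset.range (m + 2), (-1) ^ i * ((m + 1).choose i : R) * (x + b * i) ^ m = 0 := by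
  have hdeg : ((C x + C b * X : R[X]) ^ m).natDegree < m + 1 := by
    have : (C x + C b * X : R[X]).natDegree ≤ 1 := by compute_degree
    have := natDegree_pow_le_of_le m this
    omega
  have h := congr_fun (fwdDiff_iter_eq_zero_of_degree_lt hdeg) 0
  rw [fwdDiff_iter_eq_sum_shift] at h
  have h' := congrArg ((-1 : R) ^ (m + 1) * ·) h
  simp only [Pi.zero_apply, mul_zero, Finset.mul_sum] at h'
  rw [← h']
  refine Finset.sum_congr rfl fun i hi => ?_
  have hi' : i ≤ m + 1 := by
    simp only [Finset.mem_range] at hi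
    omega
  have hsign : (-1 : R) ^ (m + 1) * (-1) ^ (m + 1 - i) = (-1) ^ i := by
    obtain ⟨k, hk⟩ := Nat.exists_eq_add_of_le hi'
    rw [hk, Nat.add_sub_cancel_left, pow_add, mul_assoc, ← mul_pow]
    simp
  rw [← hsign]
  simp [zsmul_eq_mul, mul_assoc]

/-- The determinant of the `n × n` Steck matrix `Λ(x+(n−1)b, x+(n−2)b, …, x+b, x)` over
`ℚ[x]`, whose (0-indexed) `(i,j)` entry is `(x+ib)^{j−i+1}/(j−i+1)!` when `i ≤ j+1` and `0`
otherwise, equals `x(x+nb)^{n−1}/n!`. -/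
theorem stmt16 (n : ℕ) (hn : 1 ≤ n) (b : ℚ) :
    Matrix.det (Matrix.of fun i j : Fin n =>
      if (i : ℕ) ≤ (j : ℕ) + 1 then
        C ((((j : ℕ) + 1 - (i : ℕ)).factorial : ℚ))⁻¹ *
          (X + C (b * ((i : ℕ) : ℚ))) ^ ((j : ℕ) + 1 - (i : ℕ))
      else 0) =
    C ((n.factorial : ℚ))⁻¹ * (X * (X + C ((n : ℚ) * b)) ^ (n - 1)) := by
  set d : ℕ → ℚ[X] := fun k =>
    if k = 0 then 1 else C ((k.factorial : ℚ))⁻¹ * (X * (X + C ((k : ℚ) * b)) ^ (k - 1)) with hd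
  have key := det_hessenberg_of_sum_eq_zero
    (fun i j => if i ≤ j + 1 then
        C (((j + 1 - i).factorial : ℚ))⁻¹ * (X + C (b * (i : ℚ))) ^ (j + 1 - i)
      else 0)
    (fun k => (-1) ^ k * d k) (by simp [hd]) (fun i j hij => if_neg (by omega))
    (fun j => by simp) ?_ n
  · rw [key, ← mul_assoc, ← mul_pow]
    simp [hd, Nat.one_le_iff_ne_zero.mp hn]
  · intro m
    have hterm : ∀ i ∈ Finset.range (m + 2),
        ((-1) ^ i * d i) * (if i ≤ m + 1 then
          C (((m + 1 - i).factorial : ℚ))⁻¹ * (X + C (b * (i : ℚ))) ^ (m + 1 - i) else 0) =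
        (C (((m + 1).factorial : ℚ))⁻¹ * X) *
          ((-1) ^ i * ((m + 1).choose i : ℚ[X]) * (X + C b * (i : ℚ[X])) ^ m) := by
      intro i hi
      have hi' : i ≤ m + 1 := by
        simp only [Finset.mem_range] at hi
        omega
      rw [if_pos hi']
      rcases Nat.eq_zero_or_pos i with rfl | hpos
      · simp [hd]
        ring
      · have hcoef : C ((i.factorial : ℚ))⁻¹ * C (((m + 1 - i).factorial : ℚ))⁻¹ =
            C (((m + 1).factorial : ℚ))⁻¹ * ((m + 1).choose i : ℚ[X]) := by
          rw [← C_eq_natCast, ← C_mul, ← C_mul, Nat.cast_choose ℚ hi']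
          congr 1
          field_simp
        have hlin : (X + C b * (i : ℚ[X])) = X + C (b * (i : ℚ)) := by simp
        have hpow : (X + C (b * (i : ℚ))) ^ m =
            (X + C (b * (i : ℚ))) ^ (i - 1) * (X + C (b * (i : ℚ))) ^ (m + 1 - i) := by
          rw [← pow_add]
          congr 1
          omega
        simp only [hd, if_neg hpos.ne']
        rw [hlin, hpow, mul_comm (i : ℚ) b]
        linear_combination (-1) ^ i * X * (X + C (b * (i : ℚ))) ^ (i - 1) *
          (X + C (b * (i : ℚ))) ^ (m + 1 - i) * hcoef
    rw [Finset.sum_congr rfl hterm, ← Finset.mul_sum, sum_neg_one_pow_choose_mul_linear_pow,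
      mul_zero]
end

section
/- For all integers n and k with 1 ≤ k ≤ n−2 and every rational number b, the determinant g_{n;k}(x) of the n×n Steck matrix Λ(x+kb, x+(k−1)b, …, x+b, x, …, x) over ℚ[x] (where the entry x is repeated n−k times in the sequence) equals Σ_{j=0}^{k} (1/j!) · (x^{n−j}/(n−j)!) · (k−j+1)(k+1)^{j−1} · b^j, where the j = 0 term is interpreted as x^n/n! (since (k−0+1)(k+1)^{0−1} = 1). -/
open Polynomial

namespace Matrix

/-- A unit-subdiagonal Hessenberg determinant is read off from a vector that the matrix sends
to a multiple of the first basis vector. -/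
theorem det_eq_of_hessenberg_mulVec {R : Type*} [CommRing R] {N : ℕ}
    (M : Matrix (Fin (N + 1)) (Fin (N + 1)) R) (v : Fin (N + 1) → R) (d : R)
    (hzero : ∀ i j : Fin (N + 1), (j : ℕ) + 1 < i → M i j = 0)
    (hone : ∀ j : Fin N, M j.succ j.castSucc = 1)
    (hv : v (Fin.last N) = (-1) ^ N) (hMv : M *ᵥ v = Pi.single 0 d) :
    M.det = d := by
  have htri : (M.submatrix (Fin.succAbove 0) (Fin.succAbove (Fin.last N))).det = 1 := by
    rw [Matrix.det_of_isUpperTriangular]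
    · simp [hone]
    · intro i j hij
      have hij' : (j : ℕ) < i := hij
      simpa using hzero i.succ j.castSucc (by simpa using hij')
  have hadj : M.adjugate (Fin.last N) 0 = (-1) ^ N := by
    rw [Matrix.adjugate_fin_succ_eq_det_submatrix, htri]
    simp
  have key := congrFun (congrArg (M.adjugate *ᵥ ·) hMv) (Fin.last N)
  simp only [Matrix.mulVec_mulVec, Matrix.adjugate_mul, Matrix.smul_mulVec, Matrix.one_mulVec,
    Matrix.mulVec_single, Pi.smul_apply, hv, smul_eq_mul, Matrix.col_apply, hadj,
    MulOpposite.smul_eq_mul_unop, MulOpposite.unop_op] at key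
  have hu : ((-1 : R) ^ N) * (-1) ^ N = 1 := by rw [← mul_pow]; simp
  calc M.det = M.det * (-1) ^ N * (-1) ^ N := by rw [mul_assoc, hu, mul_one]
    _ = d := by rw [key, mul_right_comm, hu, one_mul]

end Matrix

namespace PowerSeries

/-- The exponential series `exp (a * t)` over `ℚ[X]`. -/
noncomputable def expScale (a : ℚ[X]) : PowerSeries ℚ[X] := rescale a (exp ℚ[X])

theorem coeff_expScale (a : ℚ[X]) (m : ℕ) :
    coeff m (expScale a) = Polynomial.C ((m.factorial : ℚ))⁻¹ * a ^ m := by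
  simp [expScale, coeff_rescale, coeff_exp, mul_comm]

theorem expScale_mul (a c : ℚ[X]) : expScale a * expScale c = expScale (a + c) :=
  exp_mul_exp_eq_exp_add a c

theorem expScale_zero : expScale 0 = 1 := by
  simp [expScale, rescale_zero]

/-- The product `(1 - b * t) * exp (c * t)`. -/
noncomputable def abelSeries (b c : ℚ[X]) : PowerSeries ℚ[X] := (1 - C b * X) * expScale c

theorem expScale_mul_abelSeries (a b c : ℚ[X]) :
    expScale a * abelSeries b c = abelSeries b (a + c) := by
  rw [abelSeries, abelSeries, mul_left_comm, expScale_mul]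

theorem coeff_zero_abelSeries (b c : ℚ[X]) : coeff 0 (abelSeries b c) = 1 := by
  have h : coeff 0 (expScale c) = 1 := by rw [coeff_expScale]; simp
  rw [coeff_zero_eq_constantCoeff] at h ⊢
  simp [abelSeries, h]

theorem coeff_succ_abelSeries (b c : ℚ[X]) (m : ℕ) :
    coeff (m + 1) (abelSeries b c) =
      Polynomial.C (((m + 1).factorial : ℚ))⁻¹ * c ^ m * (c - (m + 1) * b) := by
  have h : (Polynomial.C ((m.factorial : ℚ))⁻¹ : ℚ[X]) =
      Polynomial.C (((m + 1).factorial : ℚ))⁻¹ * (m + 1) := by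
    have h' : ((m.factorial : ℚ))⁻¹ = (((m + 1).factorial : ℚ))⁻¹ * (m + 1) := by
      rw [Nat.factorial_succ]; push_cast; field_simp
    rw [h']; simp
  have hX : coeff (m + 1) (C b * X * expScale c) = b * coeff m (expScale c) := by
    rw [mul_assoc, coeff_C_mul, coeff_succ_X_mul]
  rw [abelSeries, sub_mul, one_mul, map_sub, hX, coeff_expScale, coeff_expScale, h]
  ring

/-- The generating series of the Steck determinants: `exp (x * t)` times the truncation of
`(1 - b * t) * exp ((k + 1) * b * t)` at degree `k`. -/
noncomputable def steckSeries (k : ℕ) (b : ℚ) : PowerSeries ℚ[X] :=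
  expScale Polynomial.X *
    (trunc (k + 1) (abelSeries (Polynomial.C b) (Polynomial.C ((k + 1) * b))) :
      Polynomial ℚ[X])

theorem coeff_zero_steckSeries (k : ℕ) (b : ℚ) : coeff 0 (steckSeries k b) = 1 := by
  rw [steckSeries, coeff_mul]
  simp [-coeff_zero_eq_constantCoeff, coeff_expScale, coeff_trunc, coeff_zero_abelSeries]

/-- The recurrence of the Steck determinants, in the range of the constant entries. -/
theorem coeff_expScale_neg_X_mul_steckSeries {m k : ℕ} (hm : k < m) (b : ℚ) :
    coeff m (expScale (-Polynomial.X) * steckSeries k b) = 0 := by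
  rw [steckSeries, ← mul_assoc, expScale_mul, neg_add_cancel, expScale_zero, one_mul,
    Polynomial.coeff_coe, coeff_trunc, if_neg (by omega)]

/-- The recurrence of the Steck determinants, in the range of the arithmetic progression. -/
theorem coeff_expScale_mul_steckSeries {m k : ℕ} (h0 : m ≠ 0) (hm : m ≤ k) (b : ℚ) :
    coeff m (expScale (-(Polynomial.X + Polynomial.C (b * ((k + 1 - m : ℕ) : ℚ)))) *
      steckSeries k b) = 0 := by
  obtain ⟨m, rfl⟩ := Nat.exists_eq_succ_of_ne_zero h0
  rw [steckSeries, ← mul_assoc, expScale_mul, coeff_mul]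
  have htrunc : ∀ p ∈ Finset.HasAntidiagonal.antidiagonal m.succ, ∀ f : PowerSeries ℚ[X],
      coeff p.2 ((trunc (k + 1) f : Polynomial ℚ[X]) : PowerSeries ℚ[X]) = coeff p.2 f := by
    intro p hp f
    have := Finset.HasAntidiagonal.mem_antidiagonal.mp hp
    rw [Polynomial.coeff_coe, coeff_trunc, if_pos (by omega)]
  rw [Finset.sum_congr rfl fun p hp => by rw [htrunc p hp], ← coeff_mul,
    expScale_mul_abelSeries, Nat.succ_eq_add_one, coeff_succ_abelSeries]
  refine mul_eq_zero_of_right _ ?_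
  rw [Nat.cast_sub (by omega)]
  push_cast
  simp only [map_mul, map_sub, map_add, map_natCast, map_one]
  ring

/-- The closed form of the Steck determinants. -/
theorem coeff_steckSeries {n k : ℕ} (hk : k ≤ n) (b : ℚ) :
    coeff n (steckSeries k b) = ∑ j ∈ Finset.range (k + 1),
      Polynomial.C (((j.factorial : ℚ))⁻¹ * (((n - j).factorial : ℚ))⁻¹ *
          (((k - j + 1 : ℕ) : ℚ)) * ((k : ℚ) + 1) ^ ((j : ℤ) - 1) * b ^ j) *
        Polynomial.X ^ (n - j) := by
  rw [steckSeries, mul_comm, coeff_mul, Finset.Nat.sum_antidiagonal_eq_sum_range_succ_mk]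
  simp only [Polynomial.coeff_coe, coeff_trunc, ite_mul, zero_mul]
  rw [← Finset.sum_filter]
  have hfilter : {j ∈ Finset.range n.succ | j < k + 1} = Finset.range (k + 1) := by
    ext j; simp only [Finset.mem_filter, Finset.mem_range]; omega
  rw [hfilter]
  refine Finset.sum_congr rfl fun j hj => ?_
  rw [coeff_expScale, ← mul_assoc]
  congr 1
  have hk1 : (k : ℚ) + 1 ≠ 0 := by positivity
  rcases j with _ | j
  · rw [coeff_zero_abelSeries, one_mul]
    congr 1
    simp [hk1]
  · have hjk : j + 1 ≤ k := by simpa [Nat.lt_succ_iff] using hj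
    rw [coeff_succ_abelSeries, Nat.cast_add, Nat.cast_sub hjk]
    have hC : (j + 1 : ℚ[X]) = Polynomial.C (j + 1 : ℚ) := by simp
    rw [hC, ← Polynomial.C_pow, ← Polynomial.C_mul, ← Polynomial.C_mul, ← Polynomial.C_sub,
      ← Polynomial.C_mul, ← Polynomial.C_mul]
    have he : ((j + 1 : ℕ) : ℤ) - 1 = (j : ℕ) := by push_cast; ring
    congr 1
    rw [he, zpow_natCast, mul_pow]
    push_cast
    ring

/-- The alternating convolution of `a ^ l / l !` with a sequence, as a coefficient. -/
theorem coeff_expScale_neg_mul (a : ℚ[X]) (D : PowerSeries ℚ[X]) (m : ℕ) :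
    coeff m (expScale (-a) * D) = ∑ l ∈ Finset.range (m + 1),
      Polynomial.C ((l.factorial : ℚ))⁻¹ * a ^ l * ((-1) ^ l * coeff (m - l) D) := by
  rw [coeff_mul, Finset.Nat.sum_antidiagonal_eq_sum_range_succ_mk]
  refine Finset.sum_congr rfl fun l _ => ?_
  rw [coeff_expScale, neg_pow]
  ring

end PowerSeries

open PowerSeries in
/-- Steck determinants satisfy (and are determined by) the convolution recurrence; row `i`
carries the entry `a (N + 1 - i)`. -/
theorem det_steck_eq_coeff (N : ℕ) (a : ℕ → ℚ[X]) (D : PowerSeries ℚ[X])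
    (h0 : coeff 0 D = 1) (hD : ∀ m ≠ 0, coeff m (expScale (-a m) * D) = 0) :
    Matrix.det (Matrix.of fun i j : Fin (N + 1) =>
      if (i : ℕ) ≤ (j : ℕ) + 1 then
        Polynomial.C ((((j : ℕ) + 1 - (i : ℕ)).factorial : ℚ))⁻¹ *
          a (N + 1 - (i : ℕ)) ^ ((j : ℕ) + 1 - (i : ℕ))
      else 0) = coeff (N + 1) D := by
  refine Matrix.det_eq_of_hessenberg_mulVec _ (fun j => (-1) ^ (j : ℕ) * coeff (N - j) D) _
    (fun i j hij => ?_) (fun j => by simp) (by simp [h0, -coeff_zero_eq_constantCoeff]) ?_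
  · simp [not_le.mpr hij]
  funext i
  simp only [Matrix.mulVec, dotProduct, Matrix.of_apply]
  rw [Fin.sum_univ_eq_sum_range (fun j => (if (i : ℕ) ≤ j + 1 then
      Polynomial.C (((j + 1 - (i : ℕ)).factorial : ℚ))⁻¹ *
        a (N + 1 - (i : ℕ)) ^ (j + 1 - (i : ℕ)) else 0) * ((-1) ^ j * coeff (N - j) D)) (N + 1)]
  induction i using Fin.cases with
  | zero =>
    have h := hD (N + 1) (by simp)
    rw [coeff_expScale_neg_mul, Finset.sum_range_succ'] at h
    simp only [Fin.val_zero, Nat.zero_le, if_true, Nat.sub_zero, Pi.single_eq_same]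
    rw [add_comm, ← sub_neg_eq_add, sub_eq_zero, ← Finset.sum_neg_distrib] at h
    simp only [Nat.factorial_zero, Nat.cast_one, inv_one, map_one, pow_zero, one_mul,
      Nat.sub_zero] at h
    rw [h]
    refine Finset.sum_congr rfl fun j _ => ?_
    rw [Nat.add_sub_add_right, pow_succ (-1 : ℚ[X])]
    ring
  | succ i =>
    rw [Pi.single_eq_of_ne (Fin.succ_ne_zero i)]
    obtain ⟨i, hi⟩ := i
    obtain ⟨m, rfl⟩ := Nat.exists_eq_add_of_lt hi
    have h := hD (m + 1) (by simp)
    rw [coeff_expScale_neg_mul] at h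
    simp only [Fin.succ_mk]
    rw [show i + m + 1 + 1 = i + (m + 1 + 1) by ring, Finset.sum_range_add,
      Finset.sum_eq_zero (fun j hj => ?_), zero_add]
    · rw [← mul_zero ((-1 : ℚ[X]) ^ i), ← h, Finset.mul_sum]
      refine Finset.sum_congr rfl fun l _ => ?_
      have e1 : i + l + 1 - (i + 1) = l := by omega
      have e2 : i + (m + 1 + 1) - (i + 1) = m + 1 := by omega
      have e3 : i + m + 1 - (i + l) = m + 1 - l := by omega
      simp only [e1, e2, e3]
      rw [if_pos (by omega), pow_add]
      ring
    · have := Finset.mem_range.mp hj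
      rw [if_neg (by omega), zero_mul]

/-- The determinant `g_{n;k}(x)` of the `n × n` Steck matrix
`Λ(x+kb, x+(k−1)b, …, x+b, x, …, x)` (with `x` repeated `n−k` times) over `ℚ[x]`:
with `λ_m = x+(k+1−m)b` for `1 ≤ m ≤ k` and `λ_m = x` for `m > k`, the (0-indexed)
`(i,j)` entry is `λ_{n−i}^{j−i+1}/(j−i+1)!` when `i ≤ j+1` and `0` otherwise.  Then
`g_{n;k}(x) = Σ_{j=0}^{k} (1/j!) (x^{n−j}/(n−j)!) (k−j+1)(k+1)^{j−1} b^j`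
(where the `j = 0` term is `x^n/n!`). -/
theorem stmt17 (n k : ℕ) (hk1 : 1 ≤ k) (hk2 : k ≤ n - 2) (b : ℚ) :
    Matrix.det (Matrix.of fun i j : Fin n =>
      if (i : ℕ) ≤ (j : ℕ) + 1 then
        C ((((j : ℕ) + 1 - (i : ℕ)).factorial : ℚ))⁻¹ *
          (if n - (i : ℕ) ≤ k then
              X + C (b * ((k + 1 - (n - (i : ℕ)) : ℕ) : ℚ))
            else X) ^ ((j : ℕ) + 1 - (i : ℕ))
      else 0) =
    ∑ j ∈ Finset.range (k + 1),
      C (((j.factorial : ℚ))⁻¹ * (((n - j).factorial : ℚ))⁻¹ *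
          (((k - j + 1 : ℕ) : ℚ)) * ((k : ℚ) + 1) ^ ((j : ℤ) - 1) * b ^ j) *
        X ^ (n - j) := by
  obtain ⟨N, rfl⟩ : ∃ N, n = N + 1 := ⟨n - 1, by omega⟩
  rw [← PowerSeries.coeff_steckSeries (by omega)]
  refine det_steck_eq_coeff N
    (fun m => if m ≤ k then X + C (b * ((k + 1 - m : ℕ) : ℚ)) else X) _
    (PowerSeries.coeff_zero_steckSeries k b) fun m hm => ?_
  split_ifs with h
  · exact PowerSeries.coeff_expScale_mul_steckSeries hm h b
  · exact PowerSeries.coeff_expScale_neg_X_mul_steckSeries (not_le.mp h) b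
end

section
/- For all integers n ≥ 1 and a, b ≥ 1, the number of functions P : [n] → ℕ such that for every nonempty subset A ⊆ [n] there exists i ∈ A with P(i) < a + (n − |A|)b (i.e., the number of K_{n+1}^{a,b}-parking functions, which equals the number of standard monomials of R/M_{K_{n+1}^{a,b}}) is a(a+nb)^{n−1}. -/
open Finset in
/-- The functions `P : ι → ℕ` vanishing outside `S` that are parking functions on `S`: every
nonempty `A ⊆ S` contains some `i` with `P i < a + (|S| - |A|) b`. -/
def parkingFinset {ι : Type*} [Fintype ι] [DecidableEq ι] (b : ℕ) (S : Finset ι) (a : ℕ) :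
    Finset (ι → ℕ) :=
  {P ∈ Fintype.piFinset fun _ : ι => range (a + #S * b + 1) |
    (∀ i ∉ S, P i = 0) ∧ ∀ A ⊆ S, A.Nonempty → ∃ i ∈ A, P i < a + (#S - #A) * b}

open Finset in
theorem mem_parkingFinset {ι : Type*} [Fintype ι] [DecidableEq ι] {b : ℕ} {S : Finset ι} {a : ℕ}
    {P : ι → ℕ} : P ∈ parkingFinset b S a ↔
      (∀ i ∉ S, P i = 0) ∧ ∀ A ⊆ S, A.Nonempty → ∃ i ∈ A, P i < a + (#S - #A) * b := by
  simp only [parkingFinset, mem_filter, Fintype.mem_piFinset, mem_range, and_iff_right_iff_imp]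
  rintro ⟨h₀, h⟩ i
  by_cases hi : i ∈ S
  · obtain ⟨j, hj, hlt⟩ := h {i} (by simpa using hi) (by simp)
    rw [mem_singleton] at hj
    subst hj
    have : (#S - #{j}) * b ≤ #S * b := Nat.mul_le_mul_right _ (Nat.sub_le _ _)
    omega
  · simp [h₀ i hi]

/-- The closed form `a (a + n b) ^ (n - 1)`, with value `1` at `n = 0`. -/
def parkingNumber (b : ℕ) : ℕ → ℕ → ℕ
  | 0, _ => 1
  | n + 1, a => a * (a + (n + 1) * b) ^ n

open Finset in
theorem sum_choose_mul_parkingNumber (b m a : ℕ) :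
    ∑ k ∈ range (m + 2), (m + 1).choose k * parkingNumber b (m + 1 - k) (a + k * b) =
      parkingNumber b (m + 1) (a + 1) := by
  set M : ℤ := a + (m + 1) * b with hM
  have hterm : ∀ k ∈ range (m + 2),
      (((m + 1).choose k * parkingNumber b (m + 1 - k) (a + k * b) : ℕ) : ℤ) =
        1 ^ k * M ^ (m + 1 - k) * (m + 1).choose k -
          b * (((m + 1).choose k * (m + 1 - k) : ℕ) * M ^ (m + 1 - k - 1)) := by
    intro k hk
    obtain ⟨j, hj⟩ : ∃ j, m + 1 = k + j := Nat.exists_eq_add_of_le (by grind)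
    have hM' : M = a + (k + j) * b := by rw [hM]; congr 2; exact_mod_cast hj
    rw [show m + 1 - k = j by omega]
    cases j with
    | zero => simp [parkingNumber]
    | succ j =>
      have : (a + k * b + (j + 1) * b : ℤ) = M := by rw [hM']; push_cast; ring
      simp only [parkingNumber]
      push_cast
      rw [this, pow_succ, eq_sub_iff_add_eq.2 this]
      ring
  have hsum : ∑ k ∈ range (m + 2),
      ((((m + 1).choose k * (m + 1 - k) : ℕ) : ℤ) * M ^ (m + 1 - k - 1)) =
        (m + 1) * (1 + M) ^ m := by
    rw [sum_range_succ, add_pow 1 M m, mul_sum]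
    simp only [Nat.sub_self, mul_zero, Nat.cast_zero, zero_mul, add_zero]
    refine sum_congr rfl fun k _ => ?_
    rw [← Nat.choose_mul_succ_eq, show m + 1 - k - 1 = m - k by omega]
    push_cast
    ring
  rw [← Nat.cast_inj (R := ℤ), Nat.cast_sum, sum_congr rfl hterm, sum_sub_distrib, ← mul_sum, hsum, ← add_pow]
  simp only [parkingNumber, hM]
  push_cast
  ring

/-- Raise the values of `Q` on `T` by one, and set it to zero elsewhere. -/
def succOn {ι : Type*} [DecidableEq ι] (T : Finset ι) (Q : ι → ℕ) (i : ι) : ℕ :=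
  if i ∈ T then Q i + 1 else 0

open Finset in
theorem succOn_mem_parkingFinset {ι : Type*} [Fintype ι] [DecidableEq ι] {b a : ℕ}
    {S Z : Finset ι} (hZ : Z ⊆ S) {Q : ι → ℕ} (hQ : Q ∈ parkingFinset b (S \ Z) (a + #Z * b)) :
    succOn (S \ Z) Q ∈ parkingFinset b S (a + 1) := by
  rw [mem_parkingFinset] at hQ ⊢
  refine ⟨fun i hi => by simp [succOn, hi], fun A hA hne => ?_⟩
  by_cases hAZ : A ⊆ S \ Z
  · obtain ⟨i, hi, hlt⟩ := hQ.2 A hAZ hne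
    refine ⟨i, hi, ?_⟩
    have h₁ := card_sdiff_add_card_eq_card hZ
    have h₂ := card_le_card hAZ
    rw [show #S - #A = #Z + (#(S \ Z) - #A) by omega, add_mul]
    simp only [succOn, hAZ hi, if_true]
    omega
  · obtain ⟨i, hi, hiZ⟩ := not_subset.1 hAZ
    exact ⟨i, hi, by simp [succOn, hiZ]⟩

open Finset in
theorem parkingFinset_succ {ι : Type*} [Fintype ι] [DecidableEq ι] (b a : ℕ) (S : Finset ι) :
    parkingFinset b S (a + 1) = S.powerset.biUnion fun Z =>
      (parkingFinset b (S \ Z) (a + #Z * b)).image (succOn (S \ Z)) := by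
  ext P
  simp only [mem_biUnion, mem_powerset, mem_image]
  constructor
  · intro hP
    rw [mem_parkingFinset] at hP
    have hZ : {i ∈ S | P i = 0} ⊆ S := filter_subset _ _
    refine ⟨{i ∈ S | P i = 0}, hZ, fun i => P i - 1, ?_, ?_⟩
    · rw [mem_parkingFinset]
      refine ⟨fun i hi => ?_, fun A hA hne => ?_⟩
      · have := hP.1 i
        grind
      · obtain ⟨i, hi, hlt⟩ := hP.2 A (hA.trans sdiff_subset) hne
        refine ⟨i, hi, ?_⟩
        have h₀ : P i ≠ 0 := by
          have := hA hi
          grind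
        have h₁ := card_sdiff_add_card_eq_card hZ
        have h₂ := card_le_card hA
        rw [show #S - #A = #{i ∈ S | P i = 0} + (#(S \ {i ∈ S | P i = 0}) - #A) by omega,
          add_mul] at hlt
        omega
    · funext i
      have := hP.1 i
      simp only [succOn, mem_sdiff, mem_filter]
      grind
  · rintro ⟨Z, hZ, Q, hQ, rfl⟩
    exact succOn_mem_parkingFinset hZ hQ

open Finset in
theorem card_parkingFinset {ι : Type*} [Fintype ι] [DecidableEq ι] (b : ℕ) (S : Finset ι)
    (a : ℕ) : #(parkingFinset b S a) = parkingNumber b #S a := by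
  induction hN : a + #S * b using Nat.strong_induction_on generalizing S a with
  | _ N ih
  obtain rfl | hS := S.eq_empty_or_nonempty
  · have : parkingFinset b (∅ : Finset ι) a = {0} := by
      ext P
      simp +contextual [mem_parkingFinset, funext_iff, subset_empty]
    simp [this, parkingNumber]
  obtain ⟨m, hm⟩ : ∃ m, #S = m + 1 := Nat.exists_eq_add_of_le' hS.card_pos
  cases a with
  | zero =>
    rw [hm, parkingNumber, zero_mul, card_eq_zero, eq_empty_iff_forall_notMem]
    intro P hP
    obtain ⟨i, -, hi⟩ := (mem_parkingFinset.1 hP).2 S Subset.rfl hS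
    simp at hi
  | succ a =>
    have hcard : ∀ Z ∈ S.powerset,
        #((parkingFinset b (S \ Z) (a + #Z * b)).image (succOn (S \ Z))) =
          parkingNumber b (#S - #Z) (a + #Z * b) := by
      intro Z hZ
      rw [mem_powerset] at hZ
      have h₁ := card_sdiff_add_card_eq_card hZ
      rw [card_image_of_injOn, ih (a + #Z * b + #(S \ Z) * b) _ _ _ rfl,
        card_sdiff_of_subset hZ]
      · rw [← hN, ← h₁]
        linarith
      · intro Q hQ Q' hQ' h
        have h₂ := (mem_parkingFinset.1 hQ).1
        have h₃ := (mem_parkingFinset.1 hQ').1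
        funext i
        have := congrFun h i
        simp only [succOn] at this
        grind
    rw [parkingFinset_succ, card_biUnion, sum_congr rfl hcard,
      sum_powerset_apply_card (fun k => parkingNumber b (#S - k) (a + k * b)), hm]
    · simpa using sum_choose_mul_parkingNumber b m a
    · intro Z hZ Z' hZ' hne
      rw [Function.onFun, disjoint_left]
      simp only [mem_image, not_exists, not_and]
      rintro _ ⟨Q, -, rfl⟩ Q' - h
      refine hne (ext fun i => ?_)
      have := congrFun h i
      simp only [succOn] at this
      grind

/-- The number of `K_{n+1}^{a,b}`-parking functions (equivalently, standard monomials of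
`R/M_{K_{n+1}^{a,b}}`): functions `P : [n] → ℕ` such that for every nonempty `A ⊆ [n]`
there is `i ∈ A` with `P i < a + (n − |A|)b`.  This number is `a(a+nb)^{n−1}`. -/
theorem stmt18 (n a b : ℕ) (hn : 1 ≤ n) (ha : 1 ≤ a) (hb : 1 ≤ b) :
    {P : Fin n → ℕ | ∀ A : Finset (Fin n), A.Nonempty →
        ∃ i ∈ A, P i < a + (n - A.card) * b}.ncard =
      a * (a + n * b) ^ (n - 1) := by
  have h : {P : Fin n → ℕ | ∀ A : Finset (Fin n), A.Nonempty →
      ∃ i ∈ A, P i < a + (n - A.card) * b} = ↑(parkingFinset (ι := Fin n) b Finset.univ a) := by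
    ext P
    simp [mem_parkingFinset]
  obtain ⟨m, rfl⟩ := Nat.exists_eq_add_of_le' hn
  rw [h, Set.ncard_coe_finset, card_parkingFinset]
  simp [parkingNumber]
end

section
/- For all integers n ≥ 1, 0 ≤ k ≤ n−1 and a, b ≥ 1, the number of functions P : [n] → ℕ such that for every nonempty subset A ⊆ [n] with |A| ≤ k+1 there exists i ∈ A with P(i) < a + (n − |A|)b (i.e., the number of standard monomials of R/M^{(k)}_{K_{n+1}^{a,b}}) equals (a+(n−k−1)b)^n + Σ_{j=1}^{k} C(n,j) · (a+(n−k−1)b)^{n−j} · (k−j+1)(k+1)^{j−1} · b^j. In particular, for k = 1 this number is (a+(n−2)b)^{n−1}(a+(2n−2)b), and for k = n−2 (with n ≥ 2) it is a(a+nb)^{n−1} + (n−1)^{n−1} b^n. -/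
open Finset in
/-- The functions `P : ι → ℕ` with fewer than `m - t` values `≥ c + t * b`, for every `t < m`. -/
def staircase (b : ℕ) (ι : Type) [Fintype ι] (m c : ℕ) : Set (ι → ℕ) :=
  {P | ∀ t < m, #{i | c + t * b ≤ P i} + t < m}

open Finset in
theorem card_filter_threshold_subtype {ι : Type} [Fintype ι] {b c : ℕ} (S : Finset ι)
    (P : ι → ℕ) (Q : S → ℕ) (hS : ∀ i, i ∈ S ↔ c ≤ P i)
    (hPQ : ∀ i : S, P i = c + Q i) (t : ℕ) :
    #{i | c + (t + 1) * b ≤ P i} = #{i : S | b + t * b ≤ Q i} := by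
  symm
  refine card_bij (fun i _ => (i : ι)) ?_ (fun _ _ _ _ h => Subtype.ext h) ?_
  · intro i hi
    simp only [mem_filter, mem_univ, true_and] at hi ⊢
    rw [hPQ]; linarith
  · intro i hi
    simp only [mem_filter, mem_univ, true_and] at hi
    have hi' : i ∈ S := (hS i).2 (by nlinarith [Nat.zero_le ((t + 1) * b)])
    refine ⟨⟨i, hi'⟩, ?_, rfl⟩
    have := hPQ ⟨i, hi'⟩
    simp only [mem_filter, mem_univ, true_and]
    simp only at this
    rw [this] at hi; linarith

theorem forall_lt_succ_staircase {m : ℕ} {f : ℕ → ℕ} :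
    (∀ t < m + 1, f t + t < m + 1) ↔ f 0 ≤ m ∧ ∀ t < m, f (t + 1) + t < m := by
  constructor
  · intro h
    refine ⟨by have := h 0 (by omega); omega, fun t ht => ?_⟩
    have := h (t + 1) (by omega); omega
  · rintro ⟨h0, h⟩ t ht
    rcases t with _ | t
    · omega
    · have := h t (by omega); omega

open Finset in
/-- The members of a staircase set whose set of entries `≥ c` is `S` split into their small part
and their large part. -/
def staircaseFiberEquiv (b : ℕ) {ι : Type} [Fintype ι] [DecidableEq ι] (m c : ℕ) (S : Finset ι)
    (hS : #S ≤ m) :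
    {P : staircase b ι (m + 1) c // ({i | c ≤ P.1 i} : Finset ι) = S} ≃
      ({i // i ∉ S} → Fin c) × staircase b S m b where
  toFun P :=
    have hmem : ∀ i, i ∈ S ↔ c ≤ P.1.1 i := fun i => by
      simpa using (Finset.ext_iff.1 P.2 i).symm
    (fun i => ⟨P.1.1 i, by have := (hmem i).not.1 i.2; omega⟩,
      ⟨fun i => P.1.1 i - c, fun t ht => by
        rw [← card_filter_threshold_subtype (c := c) S P.1.1 _ hmem
          (fun i => by have := (hmem i).1 i.2; omega)]
        exact (forall_lt_succ_staircase (f := fun t => #{i | c + t * b ≤ P.1.1 i}).1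
          P.1.2).2 t ht⟩)
  invFun x :=
    have hmem : ∀ i, i ∈ S ↔ c ≤ (if h : i ∈ S then c + x.2.1 ⟨i, h⟩ else (x.1 ⟨i, h⟩ : ℕ)) := by
      intro i
      by_cases h : i ∈ S
      · simp [h]
      · simp [h]
    have heq : ({i | c ≤ (if h : i ∈ S then c + x.2.1 ⟨i, h⟩ else (x.1 ⟨i, h⟩ : ℕ))} :
        Finset ι) = S := by
      ext i
      rw [mem_filter]
      exact ⟨fun h => (hmem i).2 h.2, fun h => ⟨mem_univ i, (hmem i).1 h⟩⟩
    ⟨⟨fun i => if h : i ∈ S then c + x.2.1 ⟨i, h⟩ else (x.1 ⟨i, h⟩ : ℕ), by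
      refine (forall_lt_succ_staircase (f := fun t => #{i | c + t * b ≤ _})).2 ⟨?_, ?_⟩
      · simp only [zero_mul, add_zero]
        rw [heq]
        exact hS
      · intro t ht
        rw [card_filter_threshold_subtype S _ x.2.1 hmem (fun i => by simp)]
        exact x.2.2 t ht⟩, heq⟩
  left_inv P := by
    have hmem : ∀ i, i ∈ S ↔ c ≤ P.1.1 i := fun i => by
      simpa using (Finset.ext_iff.1 P.2 i).symm
    ext i
    by_cases h : i ∈ S
    · have := (hmem i).1 h
      simp only [h, dite_true]; omega
    · simp [h]
  right_inv x := by
    ext i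
    · simp [i.2]
    · simp

open Finset in
/-- Counting a staircase set of height `m + 1` from those of height `m` on all index sets of
size at most `m`. -/
theorem staircase_succ_count (b m : ℕ)
    (ih : ∀ (ι : Type) [Fintype ι], Fintype.card ι ≤ m → Finite (staircase b ι m b) ∧
      (m + 1) * Nat.card (staircase b ι m b) =
        (m + 1 - Fintype.card ι) * (m + 1) ^ Fintype.card ι * b ^ Fintype.card ι)
    (ι : Type) [Fintype ι] (c : ℕ) :
    Finite (staircase b ι (m + 1) c) ∧
      (m + 1) * Nat.card (staircase b ι (m + 1) c) =
        ∑ j ∈ range (Fintype.card ι + 1), (Fintype.card ι).choose j *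
          (c ^ (Fintype.card ι - j) * ((m + 1 - j) * (m + 1) ^ j * b ^ j)) := by
  classical
  let f : staircase b ι (m + 1) c → Finset ι := fun P => {i | c ≤ P.1 i}
  have hfib : ∀ S : Finset ι, Finite {P // f P = S} ∧
      (m + 1) * Nat.card {P // f P = S} =
        c ^ (Fintype.card ι - #S) * ((m + 1 - #S) * (m + 1) ^ #S * b ^ #S) := by
    intro S
    by_cases hS : #S ≤ m
    · have e := staircaseFiberEquiv b m c S hS
      obtain ⟨hfin, hcard⟩ := ih S (by simpa using hS)
      refine ⟨Finite.of_equiv _ e.symm, ?_⟩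
      rw [Nat.card_congr e, Nat.card_prod, mul_left_comm, hcard]
      simp [Nat.card_eq_fintype_card, Fintype.card_subtype_compl]
    · have : IsEmpty {P // f P = S} := by
        refine ⟨fun ⟨P, hP⟩ => hS ?_⟩
        have := P.2 0 (by omega)
        rw [← hP]
        simp only [zero_mul, add_zero] at this
        exact Nat.lt_succ_iff.1 this
      refine ⟨inferInstance, ?_⟩
      have h0 : m + 1 - #S = 0 := by omega
      simp [h0]
  have := fun S => (hfib S).1
  refine ⟨Finite.of_equiv _ (Equiv.sigmaFiberEquiv f), ?_⟩
  rw [← Nat.card_congr (Equiv.sigmaFiberEquiv f), Nat.card_sigma, mul_sum,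
    sum_congr rfl (fun S _ => (hfib S).2), ← powerset_univ,
    sum_powerset_apply_card (fun j => c ^ (Fintype.card ι - j) *
      ((m + 1 - j) * (m + 1) ^ j * b ^ j))]
  simp [card_univ]

open Finset in
theorem sum_range_choose_mul_index {R : Type*} [CommRing R] (n : ℕ) (x y : R) :
    ∑ j ∈ range (n + 1), (n.choose j : R) * (x ^ (n - j) * (j * y ^ j)) =
      n * y * (x + y) ^ (n - 1) := by
  rcases n with _ | n
  · simp
  rw [sum_range_succ', add_comm x y, Nat.add_sub_cancel, add_pow, mul_sum]
  simp only [Nat.cast_zero, zero_mul, mul_zero, add_zero]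
  refine sum_congr rfl fun j _ => ?_
  have h : ((n : R) + 1) * n.choose j = (n + 1).choose (j + 1) * (j + 1) := by
    simpa using congrArg (Nat.cast : ℕ → R) (Nat.add_one_mul_choose_eq n j)
  rw [Nat.add_sub_add_right]
  push_cast
  linear_combination (-(y * y ^ j * x ^ (n - j))) * h

open Finset in
theorem sum_range_choose_mul_sub {R : Type*} [CommRing R] (n : ℕ) (M x y : R) :
    ∑ j ∈ range (n + 1), (n.choose j : R) * (x ^ (n - j) * ((M - j) * y ^ j)) =
      M * (x + y) ^ n - n * y * (x + y) ^ (n - 1) := by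
  rw [← sum_range_choose_mul_index, add_comm x y, add_pow, mul_sum, ← sum_sub_distrib]
  exact sum_congr rfl fun j _ => by ring

open Finset in
theorem staircase_self_count (b m : ℕ) (ι : Type) [Fintype ι] (hι : Fintype.card ι ≤ m) :
    Finite (staircase b ι m b) ∧
      (m + 1) * Nat.card (staircase b ι m b) =
        (m + 1 - Fintype.card ι) * (m + 1) ^ Fintype.card ι * b ^ Fintype.card ι := by
  induction m generalizing ι with
  | zero =>
    have h0 : Fintype.card ι = 0 := by omega
    have := Fintype.card_eq_zero_iff.1 h0
    have huniv : staircase b ι 0 b = Set.univ := by ext; simp [staircase]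
    rw [huniv, h0]
    exact ⟨inferInstance, by simp⟩
  | succ m ih =>
    obtain ⟨hfin, hcard⟩ := staircase_succ_count b m (fun ι _ h => ih ι h) ι b
    refine ⟨hfin, ?_⟩
    generalize Nat.card (staircase b ι (m + 1) b) = N at hcard ⊢
    generalize Fintype.card ι = n at hcard hι ⊢
    have hsum : ((m : ℤ) + 1) * N =
        (m + 1) * (b + (m + 1) * b) ^ n - n * ((m + 1) * b) * (b + (m + 1) * b) ^ (n - 1) := by
      rw [← sum_range_choose_mul_sub]
      have := congrArg (Nat.cast : ℕ → ℤ) hcard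
      push_cast at this
      rw [this]
      refine sum_congr rfl fun j hj => ?_
      rw [mem_range] at hj
      rw [Nat.cast_sub (by omega), mul_pow]
      push_cast
      ring
    have hN : (N : ℤ) = (b + (m + 1) * b) ^ n - n * b * (b + (m + 1) * b) ^ (n - 1) := by
      have hm : ((m : ℤ) + 1) ≠ 0 := by positivity
      apply mul_left_cancel₀ hm
      linear_combination hsum
    zify [show n ≤ m + 1 + 1 by omega]
    rw [hN]
    rcases n with _ | n
    · simp
    · have : (b : ℤ) + (m + 1) * b = (m + 2) * b := by ring
      rw [this, Nat.add_sub_cancel, mul_pow, mul_pow]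
      push_cast
      ring

open Finset in
theorem staircase_count (b m : ℕ) (ι : Type) [Fintype ι] (c : ℕ) :
    (m + 1) * (staircase b ι (m + 1) c).ncard =
      ∑ j ∈ range (Fintype.card ι + 1), (Fintype.card ι).choose j *
        (c ^ (Fintype.card ι - j) * ((m + 1 - j) * (m + 1) ^ j * b ^ j)) :=
  (staircase_succ_count b m (fun ι _ h => staircase_self_count b m ι h) ι c).2

open Finset in
theorem skeleton_eq_staircase (n k a b : ℕ) (hk : k + 1 ≤ n) :
    {P : Fin n → ℕ | ∀ A : Finset (Fin n), A.Nonempty → A.card ≤ k + 1 →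
        ∃ i ∈ A, P i < a + (n - A.card) * b} =
      staircase b (Fin n) (k + 1) (a + (n - k - 1) * b) := by
  have hthr : ∀ t ≤ k, a + (n - (k + 1 - t)) * b = a + (n - k - 1) * b + t * b := by
    intro t ht
    rw [add_assoc, ← add_mul]
    congr 2
    omega
  ext P
  constructor
  · intro h t ht
    by_contra! hcon
    obtain ⟨A, hA, hAcard⟩ := exists_subset_card_eq (show k + 1 - t ≤ _ by
      exact Nat.sub_le_iff_le_add.2 hcon)
    obtain ⟨i, hi, hlt⟩ := h A (card_pos.1 (by omega)) (by omega)
    have := (mem_filter.1 (hA hi)).2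
    rw [hAcard, hthr t (by omega)] at hlt
    omega
  · intro h A hne hA
    by_contra! hcon
    have hpos := hne.card_pos
    have := h (k + 1 - #A) (by omega)
    have hle : #A ≤ #{i | a + (n - k - 1) * b + (k + 1 - #A) * b ≤ P i} := by
      refine card_le_card fun i hi => ?_
      rw [mem_filter, ← hthr _ (by omega), show k + 1 - (k + 1 - #A) = #A by omega]
      exact ⟨mem_univ _, hcon i hi⟩
    omega

open Finset in
theorem skeleton_sum_eq (n k b c : ℕ) (hk : k + 1 ≤ n) :
    ∑ j ∈ range (n + 1), n.choose j * (c ^ (n - j) * ((k + 1 - j) * (k + 1) ^ j * b ^ j)) =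
      (k + 1) * (c ^ n + ∑ j ∈ Icc 1 k,
          n.choose j * c ^ (n - j) * ((k - j + 1) * (k + 1) ^ (j - 1)) * b ^ j) := by
  have hsub : range (k + 1) ⊆ range (n + 1) := range_subset_range.2 (by omega)
  rw [← sum_subset hsub, range_eq_Ico, sum_eq_sum_Ico_succ_bot (by omega), mul_add, mul_sum]
  · congr 1
    · simp [mul_comm]
    · refine sum_congr (by ext; simp) fun j hj => ?_
      obtain ⟨h1, h2⟩ := mem_Icc.1 hj
      obtain ⟨i, rfl⟩ : ∃ i, j = i + 1 := ⟨j - 1, by omega⟩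
      rw [show k + 1 - (i + 1) = k - (i + 1) + 1 by omega, Nat.add_sub_cancel]
      ring
  · intro j _ hj
    have h0 : k + 1 - j = 0 := by rw [mem_range] at hj; omega
    simp [h0]


/-- The number of standard monomials of the `k`-skeleton ideal `M^{(k)}_{K_{n+1}^{a,b}}`:
functions `P : [n] → ℕ` such that for every nonempty `A ⊆ [n]` with `|A| ≤ k+1` there is
`i ∈ A` with `P i < a + (n − |A|)b`.  This number equals
`(a+(n−k−1)b)^n + Σ_{j=1}^{k} C(n,j)(a+(n−k−1)b)^{n−j}(k−j+1)(k+1)^{j−1}b^j`;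
in particular for `k = 1` it is `(a+(n−2)b)^{n−1}(a+(2n−2)b)`, and for `k = n−2`
(with `n ≥ 2`) it is `a(a+nb)^{n−1} + (n−1)^{n−1}b^n`. -/
theorem stmt19 (n k a b : ℕ) (hn : 1 ≤ n) (hk : k ≤ n - 1) (ha : 1 ≤ a) (hb : 1 ≤ b) :
    ({P : Fin n → ℕ | ∀ A : Finset (Fin n), A.Nonempty → A.card ≤ k + 1 →
        ∃ i ∈ A, P i < a + (n - A.card) * b}.ncard =
      (a + (n - k - 1) * b) ^ n +
        ∑ j ∈ Finset.Icc 1 k,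
          n.choose j * (a + (n - k - 1) * b) ^ (n - j) *
            ((k - j + 1) * (k + 1) ^ (j - 1)) * b ^ j) ∧
    (k = 1 →
      {P : Fin n → ℕ | ∀ A : Finset (Fin n), A.Nonempty → A.card ≤ k + 1 →
          ∃ i ∈ A, P i < a + (n - A.card) * b}.ncard =
        (a + (n - 2) * b) ^ (n - 1) * (a + (2 * n - 2) * b)) ∧
    (2 ≤ n → k = n - 2 →
      {P : Fin n → ℕ | ∀ A : Finset (Fin n), A.Nonempty → A.card ≤ k + 1 →
          ∃ i ∈ A, P i < a + (n - A.card) * b}.ncard =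
        a * (a + n * b) ^ (n - 1) + (n - 1) ^ (n - 1) * b ^ n) := by
  have hkn : k + 1 ≤ n := by omega
  have hcount := staircase_count b k (Fin n) (a + (n - k - 1) * b)
  rw [Fintype.card_fin] at hcount
  have hformula := hcount
  rw [skeleton_sum_eq n k b _ hkn] at hformula
  replace hformula := Nat.eq_of_mul_eq_mul_left (Nat.succ_pos k) hformula
  rw [skeleton_eq_staircase n k a b hkn]
  refine ⟨hformula, ?_, ?_⟩
  · rintro rfl
    rw [hformula]
    obtain ⟨r, rfl⟩ : ∃ r, n = r + 2 := ⟨n - 2, by omega⟩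
    simp only [Finset.Icc_self, Finset.sum_singleton, Nat.choose_one_right]
    rw [show r + 2 - 1 - 1 = r by omega, show r + 2 - 2 = r by omega,
      show r + 2 - 1 = r + 1 by omega, show 2 * (r + 2) - 2 = 2 * r + 2 by omega]
    ring
  · intro hn2 hkeq
    clear hformula
    obtain rfl : n = k + 2 := by omega
    generalize (staircase b (Fin (k + 2)) (k + 1) (a + (k + 2 - k - 1) * b)).ncard = N at *
    rw [show k + 2 - k - 1 = 1 by omega, one_mul, Finset.sum_range_succ] at hcount
    have hid := sum_range_choose_mul_sub (R := ℤ) (k + 2) (k + 1) (a + b) ((k + 1) * b)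
    rw [Finset.sum_range_succ] at hid
    have hpart : ∀ j ∈ Finset.range (k + 2), ((k + 2).choose j : ℤ) *
        ((a + b) ^ (k + 2 - j) * ((k + 1 - j) * ((k + 1) * b) ^ j)) =
        (((k + 2).choose j * ((a + b) ^ (k + 2 - j) *
          ((k + 1 - j) * (k + 1) ^ j * b ^ j)) : ℕ) : ℤ) := by
      intro j hj
      rw [Finset.mem_range] at hj
      push_cast [show j ≤ k + 1 by omega]
      rw [mul_pow]
      ring
    rw [Finset.sum_congr rfl hpart, ← Nat.cast_sum] at hid
    simp only [show k + 1 - (k + 2) = 0 by omega, zero_mul, mul_zero, add_zero] at hcount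
    rw [← hcount] at hid
    rw [show k + 2 - 1 = k + 1 by omega] at *
    have hk0 : ((k : ℤ) + 1) ≠ 0 := by positivity
    zify
    apply mul_left_cancel₀ hk0
    simp only [Nat.choose_self, Nat.sub_self, pow_zero] at hid
    push_cast at hid
    rw [show (a : ℤ) + b + (k + 1) * b = a + (k + 2) * b by ring, mul_pow] at hid
    linear_combination hid
end
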